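/- arXiv:2512.18350 — 8 statements merged into one kernel-verified Lean document; each statement's English description precedes it below -/
import Mathlib

section
/- Let s ∈ (0,1), let N > 2s be an integer, and let t ∈ (0, 2s). Set 2* = 2(N−t)/(N−2s) and q = 2·2*/(2*−2). Then there exist constants C > 0 and A₀ ≥ 1, depending only on N, s, t, such that for all 0 < r < R with R/r ≥ A₀, the function F_{r,R}(x) = ∫_{ℝ^N} (φ_{r,R}(x) − φ_{r,R}(y)) |x−y|^{−(N+s)} dy satisfies ( ∫_{ℝ^N} |x|^{qt/2*} |F_{r,R}(x)|^q dx )^{1/q} ≤ C (log(R/r))^{−1/2*}. -/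
open MeasureTheory

/-- The logarithmic cutoff `φ_{r,R}` : `1` for `|x| < r`, `log(R/|x|)/log(R/r)` for
`r ≤ |x| ≤ R`, and `0` for `|x| > R`. -/
noncomputable def logCutoff (N : ℕ) (r R : ℝ) (x : EuclideanSpace ℝ (Fin N)) : ℝ :=
  if ‖x‖ < r then 1
  else if ‖x‖ ≤ R then Real.log (R / ‖x‖) / Real.log (R / r)
  else 0

/-- `F_{r,R}(x) = ∫ (φ_{r,R}(x) - φ_{r,R}(y)) |x-y|^{-(N+s)} dy`, representing
`(-Δ)^{s/2} φ_{r,R}` up to a positive dimensional constant. -/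
noncomputable def cutoffFracLap (N : ℕ) (s r R : ℝ) (x : EuclideanSpace ℝ (Fin N)) : ℝ :=
  ∫ y : EuclideanSpace ℝ (Fin N),
    (logCutoff N r R x - logCutoff N r R y) * ‖x - y‖ ^ (-((N : ℝ) + s))

open MeasureTheory Module Set

section RadialIntegrals

theorem log_one_add_le_rpow {h α : ℝ} (hh : 0 ≤ h) (hα : 0 < α) :
    Real.log (1 + h) ≤ (1 + h) ^ α / α :=
  Real.log_le_rpow_div (by positivity) hα

theorem log_one_add_le_self {h : ℝ} (hh : 0 ≤ h) : Real.log (1 + h) ≤ h := by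
  have := Real.log_le_sub_one_of_pos (show (0 : ℝ) < 1 + h by positivity)
  linarith

theorem integrableOn_log_one_add_mul_rpow {s : ℝ} (hs : s ∈ Ioo (0 : ℝ) 1) :
    IntegrableOn (fun y : ℝ ↦ Real.log (1 + y) * y ^ (-(1 + s))) (Ioi 0) := by
  obtain ⟨hs0, hs1⟩ := hs
  have hmeas : Measurable (fun y : ℝ ↦ Real.log (1 + y) * y ^ (-(1 + s))) := by fun_prop
  rw [← Ioc_union_Ioi_eq_Ioi zero_le_one]
  refine IntegrableOn.union ?_ ?_
  · have h0 : IntegrableOn (fun y : ℝ ↦ y ^ (-s)) (Ioc 0 1) :=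
      (intervalIntegrable_iff_integrableOn_Ioc_of_le zero_le_one).1
        (intervalIntegral.intervalIntegrable_rpow' (by linarith))
    refine Integrable.mono' h0 hmeas.aestronglyMeasurable ?_
    filter_upwards [self_mem_ae_restrict measurableSet_Ioc] with y hy
    have hy0 : 0 < y := hy.1
    have hlog : 0 ≤ Real.log (1 + y) := Real.log_nonneg (by linarith)
    rw [Real.norm_of_nonneg (by positivity)]
    calc Real.log (1 + y) * y ^ (-(1 + s)) ≤ y * y ^ (-(1 + s)) := by
          gcongr
          exact log_one_add_le_self hy0.le
      _ = y ^ (-s) := by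
          rw [← Real.rpow_one_add' hy0.le (by linarith)]
          congr 1
          ring
  · have h1 : IntegrableOn (fun y : ℝ ↦ (2 ^ (s / 2) / (s / 2)) * y ^ (-(1 + s / 2))) (Ioi 1) :=
      (integrableOn_Ioi_rpow_of_lt (by linarith) one_pos).const_mul _
    refine Integrable.mono' h1 hmeas.aestronglyMeasurable ?_
    filter_upwards [self_mem_ae_restrict measurableSet_Ioi] with y hy
    have hy1 : 1 < y := hy
    have hy0 : 0 < y := by linarith
    have hlog : 0 ≤ Real.log (1 + y) := Real.log_nonneg (by linarith)
    rw [Real.norm_of_nonneg (by positivity)]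
    calc Real.log (1 + y) * y ^ (-(1 + s))
        ≤ ((2 * y) ^ (s / 2) / (s / 2)) * y ^ (-(1 + s)) := by
          gcongr
          refine (log_one_add_le_rpow hy0.le (half_pos hs0)).trans ?_
          gcongr
          linarith
      _ = (2 ^ (s / 2) / (s / 2)) * (y ^ (s / 2) * y ^ (-(1 + s))) := by
          rw [Real.mul_rpow zero_le_two hy0.le]
          ring
      _ = (2 ^ (s / 2) / (s / 2)) * y ^ (-(1 + s / 2)) := by
          rw [← Real.rpow_add hy0]
          congr 2
          ring

theorem pow_pred_mul_rpow {d : ℕ} (hd : 0 < d) {y : ℝ} (hy : 0 < y) (c : ℝ) :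
    y ^ (d - 1) * y ^ c = y ^ ((d : ℝ) - 1 + c) := by
  rw [← Real.rpow_natCast, ← Real.rpow_add hy, Nat.cast_pred hd]

theorem log_one_add_norm_div_mul_rpow {E : Type*} [NormedAddCommGroup E] [NormedSpace ℝ E]
    {ρ : ℝ} (hρ : 0 < ρ) (b : ℝ) (z : E) :
    Real.log (1 + ‖z‖ / ρ) * ‖z‖ ^ (-b) =
      ρ ^ (-b) * (Real.log (1 + ‖ρ⁻¹ • z‖) * ‖ρ⁻¹ • z‖ ^ (-b)) := by
  rw [norm_smul, Real.norm_of_nonneg (by positivity), Real.mul_rpow (by positivity) (by positivity),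
    Real.inv_rpow hρ.le, inv_mul_eq_div]
  have : ρ ^ (-b) ≠ 0 := by positivity
  field_simp

variable {E : Type*} [NormedAddCommGroup E] [NormedSpace ℝ E] [FiniteDimensional ℝ E]
  [MeasurableSpace E] [BorelSpace E] (μ : Measure E) [μ.IsAddHaarMeasure]

theorem integrable_log_one_add_norm_mul_rpow [Nontrivial E] {s : ℝ} (hs : s ∈ Ioo (0 : ℝ) 1) :
    Integrable (fun z : E ↦ Real.log (1 + ‖z‖) * ‖z‖ ^ (-((finrank ℝ E : ℝ) + s))) μ := by
  refine (integrable_fun_norm_addHaar μ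
    (f := fun y ↦ Real.log (1 + y) * y ^ (-((finrank ℝ E : ℝ) + s)))).2 ?_
  refine (integrableOn_congr_fun (fun y hy ↦ ?_) measurableSet_Ioi).2
    (integrableOn_log_one_add_mul_rpow hs)
  rw [smul_eq_mul, mul_left_comm, pow_pred_mul_rpow finrank_pos hy]
  congr 2
  ring

theorem integrable_posLog_inv_norm [Nontrivial E] :
    Integrable (fun z : E ↦ Real.posLog (‖z‖⁻¹)) μ := by
  refine (integrable_fun_norm_addHaar μ (f := fun y ↦ Real.posLog y⁻¹)).2 ?_
  have hmeas : Measurable (fun y : ℝ ↦ y ^ (finrank ℝ E - 1) • Real.posLog y⁻¹) := by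
    unfold Real.posLog
    fun_prop
  rw [← Ioc_union_Ioi_eq_Ioi zero_le_one]
  refine IntegrableOn.union ?_ ?_
  · have h0 : IntegrableOn (fun y : ℝ ↦ y ^ (-(1 / 2) : ℝ) / (1 / 2)) (Ioc 0 1) :=
      ((intervalIntegrable_iff_integrableOn_Ioc_of_le zero_le_one).1
        (intervalIntegral.intervalIntegrable_rpow' (by norm_num))).div_const _
    refine Integrable.mono' h0 hmeas.aestronglyMeasurable ?_
    filter_upwards [self_mem_ae_restrict measurableSet_Ioc] with y hy
    have hy0 : 0 < y := hy.1
    have hpos : 0 ≤ Real.posLog y⁻¹ := Real.posLog_nonneg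
    rw [Real.norm_of_nonneg (by positivity), smul_eq_mul]
    calc y ^ (finrank ℝ E - 1) * Real.posLog y⁻¹ ≤ 1 * Real.posLog y⁻¹ := by
          gcongr
          exact pow_le_one₀ hy0.le hy.2
      _ = Real.log y⁻¹ := by
          rw [one_mul, Real.posLog_eq_log]
          rw [abs_of_pos (by positivity)]
          exact (one_le_inv₀ hy0).2 hy.2
      _ ≤ (y⁻¹) ^ (1 / 2 : ℝ) / (1 / 2) := Real.log_le_rpow_div (by positivity) (by norm_num)
      _ = y ^ (-(1 / 2) : ℝ) / (1 / 2) := by rw [Real.inv_rpow hy0.le, Real.rpow_neg hy0.le]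
  · refine (integrableOn_congr_fun (fun y hy ↦ ?_) measurableSet_Ioi).2
      integrableOn_zero
    have hy1 : (1 : ℝ) < y := hy
    rw [(Real.posLog_eq_zero_iff _).2, smul_zero]
    rw [abs_of_pos (by positivity)]
    exact inv_le_one_of_one_le₀ hy1.le

theorem integrable_log_one_add_norm_div_mul_rpow [Nontrivial E] {s ρ : ℝ}
    (hs : s ∈ Ioo (0 : ℝ) 1) (hρ : 0 < ρ) :
    Integrable (fun z : E ↦ Real.log (1 + ‖z‖ / ρ) * ‖z‖ ^ (-((finrank ℝ E : ℝ) + s))) μ := by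
  simp_rw [log_one_add_norm_div_mul_rpow hρ]
  exact ((integrable_log_one_add_norm_mul_rpow μ hs).comp_smul (inv_ne_zero hρ.ne')).const_mul _

theorem integral_log_one_add_norm_div_mul_rpow {ρ : ℝ} (hρ : 0 < ρ) (s : ℝ) :
    ∫ z : E, Real.log (1 + ‖z‖ / ρ) * ‖z‖ ^ (-((finrank ℝ E : ℝ) + s)) ∂μ =
      ρ ^ (-s) * ∫ z : E, Real.log (1 + ‖z‖) * ‖z‖ ^ (-((finrank ℝ E : ℝ) + s)) ∂μ := by
  simp_rw [log_one_add_norm_div_mul_rpow hρ]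
  rw [integral_const_mul, Measure.integral_comp_inv_smul_of_nonneg μ
    (fun z : E ↦ Real.log (1 + ‖z‖) * ‖z‖ ^ (-((finrank ℝ E : ℝ) + s))) hρ.le, smul_eq_mul,
    ← mul_assoc, ← Real.rpow_natCast, ← Real.rpow_add hρ]
  congr 2
  ring

theorem integrable_posLog_div_norm [Nontrivial E] {ρ : ℝ} (hρ : 0 < ρ) :
    Integrable (fun z : E ↦ Real.posLog (ρ / ‖z‖)) μ := by
  refine ((integrable_posLog_inv_norm μ).comp_smul (inv_ne_zero hρ.ne')).congr (.of_forall ?_)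
  intro z
  simp [norm_smul, abs_of_pos hρ, div_eq_mul_inv, mul_comm]

theorem integral_posLog_div_norm {ρ : ℝ} (hρ : 0 < ρ) :
    ∫ z : E, Real.posLog (ρ / ‖z‖) ∂μ =
      ρ ^ (finrank ℝ E : ℝ) * ∫ z : E, Real.posLog (‖z‖⁻¹) ∂μ := by
  rw [Real.rpow_natCast, ← smul_eq_mul,
    ← Measure.integral_comp_inv_smul_of_nonneg μ (fun z : E ↦ Real.posLog (‖z‖⁻¹)) hρ.le]
  congr 1
  ext z
  simp [norm_smul, abs_of_pos hρ, div_eq_mul_inv, mul_comm]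

theorem lintegral_ofReal_fun_norm_addHaar [Nontrivial E] {f : ℝ → ℝ} (hf : ∀ y, 0 ≤ y → 0 ≤ f y)
    (hint : IntegrableOn (fun y ↦ y ^ (finrank ℝ E - 1) * f y) (Ioi 0)) :
    ∫⁻ x : E, ENNReal.ofReal (f ‖x‖) ∂μ = ENNReal.ofReal
      (finrank ℝ E * μ.real (Metric.ball 0 1) * ∫ y in Ioi 0, y ^ (finrank ℝ E - 1) * f y) := by
  rw [← ofReal_integral_eq_lintegral_ofReal ((integrable_fun_norm_addHaar μ).2 hint)
    (.of_forall fun x ↦ hf _ (norm_nonneg x)), integral_fun_norm_addHaar]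
  simp [mul_assoc]

end RadialIntegrals

section Pointwise

theorem max_min_le_mul {r R A p k : ℝ} (hr : 0 < r) (hrR : r < R) (hA : 1 ≤ A)
    (h : p ≤ A * k) : max r (min p R) ≤ A * max r (min k R) := by
  have hm : r ≤ max r (min k R) := le_max_left _ _
  refine max_le (by nlinarith) ?_
  rcases le_total k R with hk | hk
  · rw [min_eq_left hk]
    exact (min_le_left _ _).trans (h.trans (by gcongr; exact le_max_right _ _))
  · rw [min_eq_right hk, max_eq_right hrR.le]
    exact (min_le_right _ _).trans (by nlinarith)

theorem logCutoff_eq {N : ℕ} {r R : ℝ} (hr : 0 < r) (hrR : r < R)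
    (x : EuclideanSpace ℝ (Fin N)) :
    logCutoff N r R x =
      (Real.log R - Real.log (max r (min ‖x‖ R))) / Real.log (R / r) := by
  have hR : 0 < R := hr.trans hrR
  have hL : 0 < Real.log (R / r) := Real.log_pos ((one_lt_div hr).2 hrR)
  unfold logCutoff
  split_ifs with h1 h2
  · rw [min_eq_left (h1.trans hrR).le, max_eq_left h1.le, ← Real.log_div hR.ne' hr.ne',
      div_self hL.ne']
  · rw [not_lt] at h1
    rw [min_eq_left h2, max_eq_right h1, Real.log_div hR.ne' (hr.trans_le h1).ne']
  · rw [min_eq_right (not_le.1 h2).le, max_eq_right hrR.le, sub_self, zero_div]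

theorem abs_logCutoff_sub_le {N : ℕ} {r R A : ℝ} (hr : 0 < r) (hrR : r < R) (hA : 0 < A)
    {x y : EuclideanSpace ℝ (Fin N)}
    (hxy : max r (min ‖x‖ R) ≤ A * max r (min ‖y‖ R))
    (hyx : max r (min ‖y‖ R) ≤ A * max r (min ‖x‖ R)) :
    |logCutoff N r R x - logCutoff N r R y| ≤ Real.log A / Real.log (R / r) := by
  have hL : 0 < Real.log (R / r) := Real.log_pos ((one_lt_div hr).2 hrR)
  have hx : 0 < max r (min ‖x‖ R) := lt_max_of_lt_left hr
  have hy : 0 < max r (min ‖y‖ R) := lt_max_of_lt_left hr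
  have h1 := Real.log_le_log hx hxy
  have h2 := Real.log_le_log hy hyx
  rw [Real.log_mul hA.ne' hy.ne'] at h1
  rw [Real.log_mul hA.ne' hx.ne'] at h2
  rw [logCutoff_eq hr hrR, logCutoff_eq hr hrR, ← sub_div, abs_div, abs_of_pos hL]
  gcongr
  rw [abs_le]
  constructor <;> linarith

theorem abs_logCutoff_sub_le_of_norm_le {N : ℕ} {r R : ℝ} (hr : 0 < r) (hrR : r < R)
    {x : EuclideanSpace ℝ (Fin N)} (hx : ‖x‖ ≤ r) (y : EuclideanSpace ℝ (Fin N)) :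
    |logCutoff N r R x - logCutoff N r R y| ≤
      Real.log (1 + ‖x - y‖ / r) / Real.log (R / r) := by
  have hyx : ‖y‖ ≤ ‖x‖ + ‖x - y‖ := norm_le_norm_add_norm_sub x y
  have hA : 0 ≤ ‖x - y‖ / r := by positivity
  have hcx : max r (min ‖x‖ R) = r := max_eq_left ((min_le_left _ _).trans hx)
  refine abs_logCutoff_sub_le hr hrR (by positivity) ?_ ?_
  · rw [hcx]
    nlinarith [le_max_left r (min ‖y‖ R)]
  · rw [hcx, add_mul, one_mul, div_mul_cancel₀ _ hr.ne']
    refine max_le (by linarith [norm_nonneg (x - y)]) ((min_le_left _ _).trans (by linarith))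

theorem log_one_add_two_mul_le {u : ℝ} (hu : 0 ≤ u) :
    Real.log (1 + 2 * u) ≤ 2 * Real.log (1 + u) := by
  have h : (2 : ℝ) * Real.log (1 + u) = Real.log ((1 + u) ^ 2) := by
    rw [Real.log_pow]
    norm_num
  rw [h]
  exact Real.log_le_log (by positivity) (by nlinarith [sq_nonneg u])

theorem abs_logCutoff_sub_mul_le {N : ℕ} {r R b : ℝ} (hr : 0 < r) (hrR : r < R) (hb : 0 ≤ b)
    {x y : EuclideanSpace ℝ (Fin N)} (hx : x ≠ 0) (hy : y ≠ 0) :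
    |logCutoff N r R x - logCutoff N r R y| * ‖x - y‖ ^ (-b) ≤
      (2 * (Real.log (1 + ‖x - y‖ / ‖x‖) * ‖x - y‖ ^ (-b)) +
        (‖x‖ / 2) ^ (-b) * Real.posLog (‖x‖ / ‖y‖)) / Real.log (R / r) := by
  have hL : 0 < Real.log (R / r) := Real.log_pos ((one_lt_div hr).2 hrR)
  have hx0 : 0 < ‖x‖ := norm_pos_iff.2 hx
  have hy0 : 0 < ‖y‖ := norm_pos_iff.2 hy
  have hyx : ‖y‖ ≤ ‖x‖ + ‖x - y‖ := norm_le_norm_add_norm_sub x y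
  have hxy : ‖x‖ ≤ ‖y‖ + ‖x - y‖ := norm_le_norm_add_norm_sub' x y
  have hu : 0 ≤ ‖x - y‖ / ‖x‖ := by positivity
  have hlog : 0 ≤ Real.log (1 + ‖x - y‖ / ‖x‖) := Real.log_nonneg (by linarith)
  have hpl : 0 ≤ Real.posLog (‖x‖ / ‖y‖) := Real.posLog_nonneg
  have hpow : 0 ≤ ‖x - y‖ ^ (-b) := by positivity
  rcases le_or_gt (‖x‖ / 2) ‖y‖ with h | h
  · have key : |logCutoff N r R x - logCutoff N r R y| ≤
        Real.log (1 + 2 * (‖x - y‖ / ‖x‖)) / Real.log (R / r) := by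
      refine abs_logCutoff_sub_le hr hrR (by positivity)
        (max_min_le_mul hr hrR (by linarith) ?_) (max_min_le_mul hr hrR (by linarith) ?_)
      · have : ‖x - y‖ = (‖x - y‖ / ‖x‖) * ‖x‖ := by field_simp
        nlinarith
      · have : ‖x - y‖ = (‖x - y‖ / ‖x‖) * ‖x‖ := by field_simp
        nlinarith
    calc _ ≤ (2 * Real.log (1 + ‖x - y‖ / ‖x‖)) / Real.log (R / r) * ‖x - y‖ ^ (-b) := by
          gcongr
          refine key.trans ?_
          gcongr
          exact log_one_add_two_mul_le hu
      _ = (2 * (Real.log (1 + ‖x - y‖ / ‖x‖) * ‖x - y‖ ^ (-b))) / Real.log (R / r) := by ring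
      _ ≤ _ := by
          gcongr
          exact le_add_of_nonneg_right (by positivity)
  · have hA : 1 ≤ ‖x‖ / ‖y‖ := (one_le_div hy0).2 (by linarith)
    have key : |logCutoff N r R x - logCutoff N r R y| ≤
        Real.log (‖x‖ / ‖y‖) / Real.log (R / r) := by
      refine abs_logCutoff_sub_le hr hrR (by positivity)
        (max_min_le_mul hr hrR hA ?_) (max_min_le_mul hr hrR hA ?_)
      · rw [div_mul_cancel₀ _ hy0.ne']
      · nlinarith
    calc _ ≤ Real.posLog (‖x‖ / ‖y‖) / Real.log (R / r) * (‖x‖ / 2) ^ (-b) := by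
          refine mul_le_mul (key.trans ?_) ?_ hpow (by positivity)
          · gcongr
            exact le_max_right 0 _
          · exact Real.rpow_le_rpow_of_nonpos (by positivity) (by linarith) (by linarith)
      _ = ((‖x‖ / 2) ^ (-b) * Real.posLog (‖x‖ / ‖y‖)) / Real.log (R / r) := by ring
      _ ≤ _ := by
          gcongr
          exact le_add_of_nonneg_left (by positivity)

theorem abs_logCutoff_sub_mul_le_of_two_mul_le {N : ℕ} {r R b : ℝ} (hr : 0 < r) (hrR : r < R)
    (hb : 0 ≤ b) {x y : EuclideanSpace ℝ (Fin N)} (hx : 2 * R ≤ ‖x‖) (hy : y ≠ 0) :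
    |logCutoff N r R x - logCutoff N r R y| * ‖x - y‖ ^ (-b) ≤
      ((‖x‖ / 2) ^ (-b) * Real.posLog (R / ‖y‖)) / Real.log (R / r) := by
  have hL : 0 < Real.log (R / r) := Real.log_pos ((one_lt_div hr).2 hrR)
  have hR : 0 < R := hr.trans hrR
  have hx0 : 0 < ‖x‖ := by linarith
  have hy0 : 0 < ‖y‖ := norm_pos_iff.2 hy
  have hxy : ‖x‖ ≤ ‖y‖ + ‖x - y‖ := norm_le_norm_add_norm_sub' x y
  have hpl : 0 ≤ Real.posLog (R / ‖y‖) := Real.posLog_nonneg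
  have hcx : max r (min ‖x‖ R) = R := by
    rw [min_eq_right (by linarith), max_eq_right hrR.le]
  rcases le_or_gt ‖y‖ R with h | h
  · have hA : 1 ≤ R / ‖y‖ := (one_le_div hy0).2 h
    have key : |logCutoff N r R x - logCutoff N r R y| ≤
        Real.log (R / ‖y‖) / Real.log (R / r) := by
      refine abs_logCutoff_sub_le hr hrR (by positivity) ?_ ?_
      · rw [hcx, min_eq_left h]
        calc R = R / ‖y‖ * ‖y‖ := by field_simp
          _ ≤ _ := by
            gcongr
            exact le_max_right _ _
      · rw [hcx]
        exact (max_le hrR.le (min_le_right _ _)).trans (by nlinarith)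
    calc _ ≤ Real.posLog (R / ‖y‖) / Real.log (R / r) * (‖x‖ / 2) ^ (-b) := by
          refine mul_le_mul (key.trans ?_) ?_ (by positivity) (by positivity)
          · gcongr
            exact le_max_right 0 _
          · exact Real.rpow_le_rpow_of_nonpos (by positivity) (by linarith) (by linarith)
      _ = _ := by ring
  · have hcy : max r (min ‖y‖ R) = R := by rw [min_eq_right h.le, max_eq_right hrR.le]
    rw [logCutoff_eq hr hrR, logCutoff_eq hr hrR, hcx, hcy, sub_self, abs_zero, zero_mul]
    positivity

end Pointwise

section Bounds

theorem abs_cutoffFracLap_le {N : ℕ} {s r R : ℝ} {x : EuclideanSpace ℝ (Fin N)}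
    {g : EuclideanSpace ℝ (Fin N) → ℝ} (hg : Integrable g)
    (h : ∀ᵐ y, |logCutoff N r R x - logCutoff N r R y| * ‖x - y‖ ^ (-((N : ℝ) + s)) ≤ g y) :
    |cutoffFracLap N s r R x| ≤ ∫ y, g y := by
  rw [← Real.norm_eq_abs, cutoffFracLap]
  refine norm_integral_le_of_norm_le hg ?_
  filter_upwards [h] with y hy
  rwa [norm_mul, Real.norm_eq_abs, Real.norm_of_nonneg (by positivity)]

theorem exists_abs_cutoffFracLap_le {N : ℕ} (hN : 0 < N) {s : ℝ} (hs : s ∈ Ioo (0 : ℝ) 1) :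
    ∃ C : ℝ, 0 < C ∧ ∀ r R : ℝ, 0 < r → r < R → ∀ x : EuclideanSpace ℝ (Fin N),
      (‖x‖ ≤ r → |cutoffFracLap N s r R x| ≤ C / Real.log (R / r) * r ^ (-s)) ∧
      (r ≤ ‖x‖ → |cutoffFracLap N s r R x| ≤ C / Real.log (R / r) * ‖x‖ ^ (-s)) ∧
      (2 * R ≤ ‖x‖ → |cutoffFracLap N s r R x| ≤
        C / Real.log (R / r) * (R ^ (N : ℝ) * ‖x‖ ^ (-((N : ℝ) + s)))) := by
  have : NeZero N := ⟨hN.ne'⟩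
  have hs0 : 0 < s := hs.1
  have hb : 0 ≤ (N : ℝ) + s := by positivity
  set K := ∫ z : EuclideanSpace ℝ (Fin N), Real.log (1 + ‖z‖) * ‖z‖ ^ (-((N : ℝ) + s))
  set Λ := ∫ z : EuclideanSpace ℝ (Fin N), Real.posLog (‖z‖⁻¹)
  have hK0 : 0 ≤ K := integral_nonneg fun z ↦
    mul_nonneg (Real.log_nonneg (by linarith [norm_nonneg z])) (by positivity)
  have hΛ0 : 0 ≤ Λ := integral_nonneg fun z ↦ Real.posLog_nonneg
  have hfin : finrank ℝ (EuclideanSpace ℝ (Fin N)) = N := by simp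
  have near_int {ρ : ℝ} (hρ : 0 < ρ) (x : EuclideanSpace ℝ (Fin N)) :
      Integrable (fun y : EuclideanSpace ℝ (Fin N) ↦
        Real.log (1 + ‖x - y‖ / ρ) * ‖x - y‖ ^ (-((N : ℝ) + s))) := by
    have := (integrable_log_one_add_norm_div_mul_rpow
      (volume : Measure (EuclideanSpace ℝ (Fin N))) hs hρ).comp_sub_left x
    rwa [hfin] at this
  have near_eq {ρ : ℝ} (hρ : 0 < ρ) (x : EuclideanSpace ℝ (Fin N)) :
      ∫ y : EuclideanSpace ℝ (Fin N),
        Real.log (1 + ‖x - y‖ / ρ) * ‖x - y‖ ^ (-((N : ℝ) + s)) = ρ ^ (-s) * K := by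
    rw [integral_sub_left_eq_self (fun z : EuclideanSpace ℝ (Fin N) ↦
      Real.log (1 + ‖z‖ / ρ) * ‖z‖ ^ (-((N : ℝ) + s))) volume x]
    have := integral_log_one_add_norm_div_mul_rpow
      (volume : Measure (EuclideanSpace ℝ (Fin N))) hρ s
    rwa [hfin] at this
  have far_int {ρ : ℝ} (hρ : 0 < ρ) :
      Integrable (fun y : EuclideanSpace ℝ (Fin N) ↦ Real.posLog (ρ / ‖y‖)) :=
    integrable_posLog_div_norm volume hρ
  have far_eq {ρ : ℝ} (hρ : 0 < ρ) :
      ∫ y : EuclideanSpace ℝ (Fin N), Real.posLog (ρ / ‖y‖) = ρ ^ (N : ℝ) * Λ := by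
    rw [integral_posLog_div_norm volume hρ, hfin]
  have hne : ∀ᵐ y : EuclideanSpace ℝ (Fin N), y ≠ 0 := Measure.ae_ne volume 0
  have hhalf {p : ℝ} (hp : 0 < p) :
      (p / 2) ^ (-((N : ℝ) + s)) = 2 ^ ((N : ℝ) + s) * p ^ (-((N : ℝ) + s)) := by
    rw [Real.div_rpow hp.le zero_le_two, Real.rpow_neg zero_le_two, div_inv_eq_mul, mul_comm]
  refine ⟨2 * K + 2 ^ ((N : ℝ) + s) * Λ + 1, by positivity, fun r R hr hrR x ↦ ?_⟩
  have hR : 0 < R := hr.trans hrR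
  have hL : 0 < Real.log (R / r) := Real.log_pos ((one_lt_div hr).2 hrR)
  have h2 : 0 ≤ 2 ^ ((N : ℝ) + s) * Λ := by positivity
  refine ⟨fun hx ↦ ?_, fun hx ↦ ?_, fun hx ↦ ?_⟩
  · calc |cutoffFracLap N s r R x|
        ≤ ∫ y : EuclideanSpace ℝ (Fin N),
          (Real.log (1 + ‖x - y‖ / r) * ‖x - y‖ ^ (-((N : ℝ) + s))) / Real.log (R / r) := by
          refine abs_cutoffFracLap_le ((near_int hr x).div_const _) (.of_forall fun y ↦ ?_)
          rw [mul_div_right_comm]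
          gcongr
          exact abs_logCutoff_sub_le_of_norm_le hr hrR hx y
      _ = K / Real.log (R / r) * r ^ (-s) := by
          rw [integral_div, near_eq hr]
          ring
      _ ≤ _ := by
          gcongr
          linarith
  · have hx0 : 0 < ‖x‖ := hr.trans_le hx
    calc |cutoffFracLap N s r R x|
        ≤ ∫ y : EuclideanSpace ℝ (Fin N),
          (2 * (Real.log (1 + ‖x - y‖ / ‖x‖) * ‖x - y‖ ^ (-((N : ℝ) + s))) +
            (‖x‖ / 2) ^ (-((N : ℝ) + s)) * Real.posLog (‖x‖ / ‖y‖)) / Real.log (R / r) := by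
          refine abs_cutoffFracLap_le ((((near_int hx0 x).const_mul _).add
            ((far_int hx0).const_mul _)).div_const _) ?_
          filter_upwards [hne] with y hy
          exact abs_logCutoff_sub_mul_le hr hrR hb (norm_pos_iff.1 hx0) hy
      _ = (2 * K + 2 ^ ((N : ℝ) + s) * Λ) / Real.log (R / r) * ‖x‖ ^ (-s) := by
          rw [integral_div, integral_add ((near_int hx0 x).const_mul _)
            ((far_int hx0).const_mul _), integral_const_mul, integral_const_mul, near_eq hx0,
            far_eq hx0, hhalf hx0]
          have : ‖x‖ ^ (-s) = ‖x‖ ^ (-((N : ℝ) + s)) * ‖x‖ ^ (N : ℝ) := by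
            rw [← Real.rpow_add hx0]
            congr 1
            ring
          rw [this]
          ring
      _ ≤ _ := by
          gcongr ?_ / _ * _
          linarith
  · have hx0 : 0 < ‖x‖ := by linarith
    calc |cutoffFracLap N s r R x|
        ≤ ∫ y : EuclideanSpace ℝ (Fin N),
          ((‖x‖ / 2) ^ (-((N : ℝ) + s)) * Real.posLog (R / ‖y‖)) / Real.log (R / r) := by
          refine abs_cutoffFracLap_le (((far_int hR).const_mul _).div_const _) ?_
          filter_upwards [hne] with y hy
          exact abs_logCutoff_sub_mul_le_of_two_mul_le hr hrR hb hx hy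
      _ = 2 ^ ((N : ℝ) + s) * Λ / Real.log (R / r) *
          (R ^ (N : ℝ) * ‖x‖ ^ (-((N : ℝ) + s))) := by
          rw [integral_div, integral_const_mul, far_eq hR, hhalf hx0]
          ring
      _ ≤ _ := by
          gcongr
          linarith

/-- Radial majorant of `‖x‖ ^ a * |cutoffFracLap N s r R x| ^ q`, up to a constant factor, when
`a - s * q = -N`. -/
noncomputable def radialMajorant (N : ℕ) (a q r R y : ℝ) : ℝ :=
  if y ≤ r then r ^ (-((N : ℝ) + a)) * y ^ a
  else if y ≤ 2 * R then y ^ (-(N : ℝ))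
  else R ^ (N * q) * y ^ (-((N : ℝ) + N * q))

theorem radialMajorant_nonneg {N : ℕ} {a q r R y : ℝ} (hr : 0 ≤ r) (hR : 0 ≤ R) (hy : 0 ≤ y) :
    0 ≤ radialMajorant N a q r R y := by
  unfold radialMajorant
  split_ifs <;> positivity

theorem integral_radialMajorant_le {N : ℕ} (hN : 0 < N) {a q r R : ℝ} (ha : 0 < a) (hq : 0 < q)
    (hr : 0 < r) (hrR : r < R) :
    IntegrableOn (fun y ↦ y ^ (N - 1) * radialMajorant N a q r R y) (Ioi 0) ∧
    ∫ y in Ioi 0, y ^ (N - 1) * radialMajorant N a q r R y ≤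
      1 / (N + a) + (Real.log 2 + Real.log (R / r)) + 1 / (N * q) := by
  have hR : 0 < R := hr.trans hrR
  have hN' : (0 : ℝ) < N := by exact_mod_cast hN
  have hNq : 0 < N * q := by positivity
  have hr2 : r ≤ 2 * R := by linarith
  have e1 : EqOn (fun y ↦ y ^ (N - 1) * radialMajorant N a q r R y)
      (fun y ↦ r ^ (-((N : ℝ) + a)) * y ^ ((N : ℝ) - 1 + a)) (Ioc 0 r) := fun y hy ↦ by
    simp only [radialMajorant, if_pos hy.2]
    rw [mul_left_comm, pow_pred_mul_rpow hN hy.1]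
  have e2 : EqOn (fun y ↦ y ^ (N - 1) * radialMajorant N a q r R y)
      (fun y ↦ y⁻¹) (Ioc r (2 * R)) := fun y hy ↦ by
    simp only [radialMajorant, if_neg (not_le.2 hy.1), if_pos hy.2]
    rw [pow_pred_mul_rpow hN (hr.trans hy.1), ← Real.rpow_neg_one]
    congr 1
    ring
  have e3 : EqOn (fun y ↦ y ^ (N - 1) * radialMajorant N a q r R y)
      (fun y ↦ R ^ (N * q) * y ^ (-1 - N * q)) (Ioi (2 * R)) := fun y hy ↦ by
    have hy' : 2 * R < y := hy
    simp only [radialMajorant, if_neg (not_le.2 (hr2.trans_lt hy')), if_neg (not_le.2 hy')]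
    rw [mul_left_comm, pow_pred_mul_rpow hN (by linarith)]
    congr 2
    ring
  have i1 : IntegrableOn (fun y ↦ y ^ (N - 1) * radialMajorant N a q r R y) (Ioc 0 r) :=
    (integrableOn_congr_fun e1 measurableSet_Ioc).2
      (((intervalIntegrable_iff_integrableOn_Ioc_of_le hr.le).1
        (intervalIntegral.intervalIntegrable_rpow' (by linarith))).const_mul _)
  have i2 : IntegrableOn (fun y ↦ y ^ (N - 1) * radialMajorant N a q r R y) (Ioc r (2 * R)) := by
    refine (integrableOn_congr_fun e2 measurableSet_Ioc).2 ?_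
    refine (intervalIntegrable_iff_integrableOn_Ioc_of_le hr2).1
      (intervalIntegral.intervalIntegrable_inv (fun y hy ↦ ?_) continuousOn_id)
    rw [uIcc_of_le hr2] at hy
    exact (hr.trans_le hy.1).ne'
  have i3 : IntegrableOn (fun y ↦ y ^ (N - 1) * radialMajorant N a q r R y) (Ioi (2 * R)) :=
    (integrableOn_congr_fun e3 measurableSet_Ioi).2
      ((integrableOn_Ioi_rpow_of_lt (by linarith) (by positivity)).const_mul _)
  have v1 : ∫ y in Ioc 0 r, y ^ (N - 1) * radialMajorant N a q r R y = 1 / (N + a) := by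
    rw [setIntegral_congr_fun measurableSet_Ioc e1, integral_const_mul,
      ← intervalIntegral.integral_of_le hr.le, integral_rpow (Or.inl (by linarith)),
      sub_add_eq_add_sub, sub_add_cancel, Real.zero_rpow (by positivity), sub_zero,
      mul_div_assoc', ← Real.rpow_add hr, neg_add_cancel, Real.rpow_zero]
  have v2 : ∫ y in Ioc r (2 * R), y ^ (N - 1) * radialMajorant N a q r R y =
      Real.log 2 + Real.log (R / r) := by
    rw [setIntegral_congr_fun measurableSet_Ioc e2, ← intervalIntegral.integral_of_le hr2,
      integral_inv_of_pos hr (by positivity), mul_div_assoc,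
      Real.log_mul two_ne_zero (by positivity)]
  have v3 : ∫ y in Ioi (2 * R), y ^ (N - 1) * radialMajorant N a q r R y ≤ 1 / (N * q) := by
    rw [setIntegral_congr_fun measurableSet_Ioi e3, integral_const_mul,
      integral_Ioi_rpow_of_lt (by linarith) (by positivity),
      show -1 - N * q + 1 = -(N * q) by ring, neg_div_neg_eq, mul_div_assoc']
    gcongr
    calc R ^ (N * q) * (2 * R) ^ (-(N * q)) ≤ R ^ (N * q) * R ^ (-(N * q)) := by
          refine mul_le_mul_of_nonneg_left ?_ (by positivity)
          exact Real.rpow_le_rpow_of_nonpos hR (by linarith) (by linarith)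
      _ = 1 := by rw [← Real.rpow_add hR, add_neg_cancel, Real.rpow_zero]
  have hU1 : Ioc 0 r ∪ Ioi r = Ioi 0 := Ioc_union_Ioi_eq_Ioi hr.le
  have hU2 : Ioc r (2 * R) ∪ Ioi (2 * R) = Ioi r := Ioc_union_Ioi_eq_Ioi hr2
  have i23 : IntegrableOn (fun y ↦ y ^ (N - 1) * radialMajorant N a q r R y) (Ioi r) :=
    hU2 ▸ i2.union i3
  refine ⟨hU1 ▸ i1.union i23, ?_⟩
  rw [← hU1, setIntegral_union (Ioc_disjoint_Ioi le_rfl) measurableSet_Ioi i1 i23, ← hU2,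
    setIntegral_union (Ioc_disjoint_Ioi le_rfl) measurableSet_Ioi i2 i3, v1, v2]
  linarith

theorem mul_abs_rpow_le_radialMajorant {N : ℕ} {s a q r R M F p : ℝ} (hr : 0 < r) (hrR : r < R)
    (hq : 0 < q) (hasq : a - s * q = -(N : ℝ)) (hM : 0 ≤ M) (hp : 0 ≤ p)
    (h1 : p ≤ r → |F| ≤ M * r ^ (-s)) (h2 : r ≤ p → |F| ≤ M * p ^ (-s))
    (h3 : 2 * R ≤ p → |F| ≤ M * (R ^ (N : ℝ) * p ^ (-((N : ℝ) + s)))) :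
    p ^ a * |F| ^ q ≤ M ^ q * radialMajorant N a q r R p := by
  have hR : 0 < R := hr.trans hrR
  unfold radialMajorant
  split_ifs with hpr hpR
  · calc p ^ a * |F| ^ q ≤ p ^ a * (M * r ^ (-s)) ^ q := by
          gcongr
          exact h1 hpr
      _ = _ := by
          rw [Real.mul_rpow hM (by positivity), ← Real.rpow_mul hr.le,
            show -s * q = -((N : ℝ) + a) by linarith]
          ring
  · have hp0 : 0 < p := by linarith
    calc p ^ a * |F| ^ q ≤ p ^ a * (M * p ^ (-s)) ^ q := by
          gcongr
          exact h2 (by linarith)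
      _ = M ^ q * (p ^ a * p ^ (-s * q)) := by
          rw [Real.mul_rpow hM (by positivity), ← Real.rpow_mul hp]
          ring
      _ = _ := by
          rw [← Real.rpow_add hp0, show a + -s * q = -(N : ℝ) by linarith]
  · have hp0 : 0 < p := by linarith
    calc p ^ a * |F| ^ q ≤ p ^ a * (M * (R ^ (N : ℝ) * p ^ (-((N : ℝ) + s)))) ^ q := by
          gcongr
          exact h3 (by linarith)
      _ = M ^ q * (R ^ (N * q) * (p ^ a * p ^ (-((N : ℝ) + s) * q))) := by
          rw [Real.mul_rpow hM (by positivity), Real.mul_rpow (by positivity) (by positivity),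
            ← Real.rpow_mul hp, ← Real.rpow_mul hR.le]
          ring
      _ = _ := by
          rw [← Real.rpow_add hp0, show a + -((N : ℝ) + s) * q = -((N : ℝ) + N * q) by linarith]

end Bounds

/-- For `s ∈ (0,1)`, integer `N > 2s`, `t ∈ (0,2s)`,
`2* = 2(N-t)/(N-2s)`, `q = 2·2*/(2*-2)`: there are `C > 0`, `A₀ ≥ 1` depending only on
`N, s, t` such that for all `0 < r < R` with `R/r ≥ A₀`,
`(∫ |x|^{qt/2*} |F_{r,R}(x)|^q dx)^{1/q} ≤ C (log(R/r))^{-1/2*}`. -/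
theorem statement2 (N : ℕ) (s t : ℝ) (hs : s ∈ Set.Ioo (0 : ℝ) 1) (hN : 2 * s < N)
    (ht : t ∈ Set.Ioo (0 : ℝ) (2 * s)) (twoStar q : ℝ)
    (htwoStar : twoStar = 2 * ((N : ℝ) - t) / ((N : ℝ) - 2 * s))
    (hq : q = 2 * twoStar / (twoStar - 2)) :
    ∃ C A₀ : ℝ, 0 < C ∧ 1 ≤ A₀ ∧ ∀ r R : ℝ, 0 < r → r < R → A₀ ≤ R / r →
      (∫⁻ x : EuclideanSpace ℝ (Fin N),
          ENNReal.ofReal (‖x‖ ^ (q * t / twoStar) * |cutoffFracLap N s r R x| ^ q)) ^ (1 / q)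
        ≤ ENNReal.ofReal (C * Real.log (R / r) ^ (-(1 / twoStar))) := by
  obtain ⟨hs0, hs1⟩ := hs
  obtain ⟨ht0, hts⟩ := ht
  have hN0 : 0 < N := by
    have : (0 : ℝ) < N := by linarith
    exact_mod_cast this
  have : NeZero N := ⟨hN0.ne'⟩
  have hd : 0 < (N : ℝ) - 2 * s := by linarith
  have hd2 : 0 < 2 * s - t := by linarith
  have hNt : 0 < (N : ℝ) - t := by linarith
  have h2s : twoStar - 2 = 2 * (2 * s - t) / ((N : ℝ) - 2 * s) := by
    rw [htwoStar]
    field_simp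
    ring
  have h2pos : 0 < twoStar := by rw [htwoStar]; positivity
  have hq' : q = 2 * ((N : ℝ) - t) / (2 * s - t) := by
    rw [hq, h2s, htwoStar]
    field_simp
  have hq0 : 0 < q := by rw [hq']; positivity
  have hqinv : 1 / q = 1 / 2 - 1 / twoStar := by
    rw [hq', htwoStar]
    field_simp
    ring
  set a := q * t / twoStar with ha
  have ha0 : 0 < a := by positivity
  have hasq : a - s * q = -(N : ℝ) := by
    rw [ha, hq', htwoStar]
    field_simp
    ring
  obtain ⟨C₀, hC₀, hF⟩ := exists_abs_cutoffFracLap_le hN0 ⟨hs0, hs1⟩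
  set ω := (N : ℝ) * volume.real (Metric.ball (0 : EuclideanSpace ℝ (Fin N)) 1) with hω
  have hω0 : 0 ≤ ω := by positivity
  set D := 1 / ((N : ℝ) + a) + 2 + 1 / (N * q) with hD
  have hD0 : 0 < D := by positivity
  refine ⟨C₀ * (ω * D) ^ (1 / q) + 1, Real.exp 1, by positivity,
    Real.one_le_exp zero_le_one, fun r R hr hrR hA ↦ ?_⟩
  have hR : 0 < R := hr.trans hrR
  set L := Real.log (R / r) with hL
  have hL1 : 1 ≤ L := (Real.le_log_iff_exp_le (by positivity)).2 hA
  have hL0 : 0 < L := by linarith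
  obtain ⟨hint, hle⟩ := integral_radialMajorant_le hN0 ha0 hq0 hr hrR
  have hfin : finrank ℝ (EuclideanSpace ℝ (Fin N)) = N := by simp
  have hlog2 : Real.log 2 ≤ 1 := by linarith [Real.log_two_lt_d9]
  have hDL : 1 / ((N : ℝ) + a) + (Real.log 2 + L) + 1 / (N * q) ≤ D * L := by
    have h1 : 0 ≤ 1 / ((N : ℝ) + a) := by positivity
    have h2 : 0 ≤ 1 / (N * q) := by positivity
    rw [hD]
    nlinarith
  have hmain : ∫⁻ x : EuclideanSpace ℝ (Fin N),
      ENNReal.ofReal (‖x‖ ^ a * |cutoffFracLap N s r R x| ^ q) ≤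
        ENNReal.ofReal ((C₀ / L) ^ q * (ω * (D * L))) := by
    calc _ ≤ ∫⁻ x : EuclideanSpace ℝ (Fin N), ENNReal.ofReal ((C₀ / L) ^ q) *
          ENNReal.ofReal (radialMajorant N a q r R ‖x‖) := by
          refine lintegral_mono fun x ↦ ?_
          rw [← ENNReal.ofReal_mul (by positivity)]
          obtain ⟨h1, h2, h3⟩ := hF r R hr hrR x
          exact ENNReal.ofReal_le_ofReal (mul_abs_rpow_le_radialMajorant hr hrR hq0 hasq
            (by positivity) (norm_nonneg x) h1 h2 h3)
      _ = ENNReal.ofReal ((C₀ / L) ^ q * (ω * ∫ y in Ioi 0, y ^ (N - 1) *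
          radialMajorant N a q r R y)) := by
          rw [lintegral_const_mul' _ _ ENNReal.ofReal_ne_top, lintegral_ofReal_fun_norm_addHaar
            volume (fun y hy ↦ radialMajorant_nonneg hr.le hR.le hy) (by rwa [hfin]), hfin,
            ENNReal.ofReal_mul (p := (C₀ / L) ^ q) (by positivity)]
      _ ≤ _ := by
          gcongr
          exact hle.trans hDL
  calc _ ≤ ENNReal.ofReal ((C₀ / L) ^ q * (ω * (D * L))) ^ (1 / q) := by gcongr
    _ = ENNReal.ofReal (((C₀ / L) ^ q * (ω * (D * L))) ^ (1 / q)) :=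
        ENNReal.ofReal_rpow_of_nonneg (by positivity) (by positivity)
    _ ≤ _ := by
        refine ENNReal.ofReal_le_ofReal ?_
        calc ((C₀ / L) ^ q * (ω * (D * L))) ^ (1 / q)
            = C₀ * (ω * D) ^ (1 / q) * (L ^ (1 / q) * L⁻¹) := by
              rw [← mul_assoc ω, Real.mul_rpow (by positivity) (by positivity),
                Real.mul_rpow (by positivity) hL0.le, ← Real.rpow_mul (by positivity),
                mul_one_div_cancel hq0.ne', Real.rpow_one]
              ring
          _ ≤ C₀ * (ω * D) ^ (1 / q) * L ^ (-(1 / twoStar)) := by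
              gcongr
              rw [← Real.rpow_neg_one L, ← Real.rpow_add hL0]
              exact Real.rpow_le_rpow_of_exponent_le hL1 (by linarith)
          _ ≤ _ := by
              gcongr
              linarith
end

section
/- Let N ≥ 1 be an integer and s ∈ (0,1). There exists a constant C > 0, depending only on N and s, such that for all 0 < r < R and every x ∈ ℝ^N with |x| < r, one has ∫_{r < |y| < R} log(|y|/r) · |x−y|^{−(N+s)} dy ≤ C r^{−s} (1 + √(log(R/r))). -/
open MeasureTheory

/-- The profile `t ↦ log (1 + t) * t ^ (-(1 + s))` is integrable on the half-line. -/
lemma integrableOn_log_one_add_mul_rpow_s5 {s : ℝ} (hs₀ : 0 < s) (hs₁ : s < 1) :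
    IntegrableOn (fun t : ℝ => Real.log (1 + t) * t ^ (-(1 + s))) (Set.Ioi 0) := by
  have hmeas : Measurable fun t : ℝ => Real.log (1 + t) * t ^ (-(1 + s)) := by fun_prop
  rw [← Set.Ioc_union_Ioi_eq_Ioi zero_le_one]
  refine IntegrableOn.union ?_ ?_
  · have hint : IntegrableOn (fun t : ℝ => t ^ (-s)) (Set.Ioc 0 1) := by
      rw [← intervalIntegrable_iff_integrableOn_Ioc_of_le zero_le_one]
      exact intervalIntegral.intervalIntegrable_rpow' (by linarith)
    refine Integrable.mono' hint hmeas.aestronglyMeasurable ?_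
    filter_upwards [ae_restrict_mem measurableSet_Ioc] with t ht
    have ht₀ : 0 < t := ht.1
    have hlog : 0 ≤ Real.log (1 + t) := Real.log_nonneg (by linarith)
    rw [Real.norm_of_nonneg (by positivity)]
    calc Real.log (1 + t) * t ^ (-(1 + s)) ≤ t * t ^ (-(1 + s)) := by
          gcongr
          linarith [Real.log_le_sub_one_of_pos (show 0 < 1 + t by linarith)]
      _ = t ^ (-s) := by
          rw [← Real.rpow_one_add' ht₀.le (by linarith)]
          congr 1
          ring
  · have hint : IntegrableOn (fun t : ℝ => 2 ^ (s / 2) / (s / 2) * t ^ (-(1 + s / 2)))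
        (Set.Ioi 1) :=
      (integrableOn_Ioi_rpow_of_lt (by linarith) zero_lt_one).const_mul _
    refine Integrable.mono' hint hmeas.aestronglyMeasurable ?_
    filter_upwards [ae_restrict_mem measurableSet_Ioi] with t ht
    have ht₁ : 1 < t := ht
    have ht₀ : 0 < t := by linarith
    have hlog : 0 ≤ Real.log (1 + t) := Real.log_nonneg (by linarith)
    rw [Real.norm_of_nonneg (by positivity)]
    calc Real.log (1 + t) * t ^ (-(1 + s))
        ≤ (2 * t) ^ (s / 2) / (s / 2) * t ^ (-(1 + s)) := by
          gcongr
          exact (Real.log_le_log (by linarith) (by linarith)).trans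
            (Real.log_le_rpow_div (by linarith) (by linarith))
      _ = 2 ^ (s / 2) / (s / 2) * (t ^ (s / 2) * t ^ (-(1 + s))) := by
          rw [Real.mul_rpow zero_le_two ht₀.le]
          ring
      _ = 2 ^ (s / 2) / (s / 2) * t ^ (-(1 + s / 2)) := by
          rw [← Real.rpow_add ht₀]
          congr 2
          ring

lemma integrable_log_one_add_norm_mul_rpow_s5 {N : ℕ} (hN : 1 ≤ N) {s : ℝ} (hs₀ : 0 < s)
    (hs₁ : s < 1) :
    Integrable fun w : EuclideanSpace ℝ (Fin N) =>
      Real.log (1 + ‖w‖) * ‖w‖ ^ (-((N : ℝ) + s)) := by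
  have : Nonempty (Fin N) := ⟨⟨0, hN⟩⟩
  have : Nontrivial (EuclideanSpace ℝ (Fin N)) := inferInstance
  rw [integrable_fun_norm_addHaar volume
    (f := fun t : ℝ => Real.log (1 + t) * t ^ (-((N : ℝ) + s)))]
  refine (integrableOn_log_one_add_mul_rpow_s5 hs₀ hs₁).congr_fun (fun t ht => ?_)
    measurableSet_Ioi
  have ht₀ : 0 < t := ht
  rw [finrank_euclideanSpace_fin, smul_eq_mul, mul_left_comm, ← Real.rpow_natCast,
    ← Real.rpow_add ht₀]
  push_cast [hN]
  congr 2
  ring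

/-- For `N ≥ 1`, `s ∈ (0,1)` there is `C = C(N,s) > 0` such that for all
`0 < r < R` and every `x` with `|x| < r`,
`∫_{r<|y|<R} log(|y|/r) |x-y|^{-(N+s)} dy ≤ C r^{-s} (1 + √(log(R/r)))`. -/
theorem statement5 (N : ℕ) (hN : 1 ≤ N) (s : ℝ) (hs : s ∈ Set.Ioo (0 : ℝ) 1) :
    ∃ C : ℝ, 0 < C ∧ ∀ r R : ℝ, 0 < r → r < R →
      ∀ x : EuclideanSpace ℝ (Fin N), ‖x‖ < r →
      ∫⁻ y in {y : EuclideanSpace ℝ (Fin N) | r < ‖y‖ ∧ ‖y‖ < R},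
          ENNReal.ofReal (Real.log (‖y‖ / r) * ‖x - y‖ ^ (-((N : ℝ) + s)))
        ≤ ENNReal.ofReal (C * r ^ (-s) * (1 + Real.sqrt (Real.log (R / r)))) := by
  set G : EuclideanSpace ℝ (Fin N) → ℝ :=
    fun w => Real.log (1 + ‖w‖) * ‖w‖ ^ (-((N : ℝ) + s)) with hG
  have hGint : Integrable G := integrable_log_one_add_norm_mul_rpow_s5 hN hs.1 hs.2
  have hG₀ : ∀ w, 0 ≤ G w := fun w =>
    mul_nonneg (Real.log_nonneg (by linarith [norm_nonneg w])) (by positivity)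
  have hI : 0 ≤ ∫ w, G w := integral_nonneg hG₀
  refine ⟨(∫ w, G w) + 1, by linarith, fun r R hr _ x hx => ?_⟩
  set F : EuclideanSpace ℝ (Fin N) → ℝ :=
    fun y => r ^ (-((N : ℝ) + s)) * G (r⁻¹ • (x - y)) with hF
  have hFint : Integrable F :=
    ((hGint.comp_smul (inv_ne_zero hr.ne')).comp_sub_left x).const_mul _
  have hF₀ : ∀ y, 0 ≤ F y := fun y => mul_nonneg (by positivity) (hG₀ _)
  have hFI : ∫ y, F y = (∫ w, G w) * r ^ (-s) := by
    rw [hF, integral_const_mul, integral_sub_left_eq_self (fun z => G (r⁻¹ • z)) volume x,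
      Measure.integral_comp_inv_smul_of_nonneg _ _ hr.le, finrank_euclideanSpace_fin,
      smul_eq_mul, ← mul_assoc, ← Real.rpow_natCast, ← Real.rpow_add hr, mul_comm]
    congr 2
    ring
  have hbound : ∀ y ∈ {y : EuclideanSpace ℝ (Fin N) | r < ‖y‖ ∧ ‖y‖ < R},
      Real.log (‖y‖ / r) * ‖x - y‖ ^ (-((N : ℝ) + s)) ≤ F y := by
    rintro y ⟨hy, -⟩
    have hnorm : ‖r⁻¹ • (x - y)‖ = r⁻¹ * ‖x - y‖ := by
      rw [norm_smul, norm_inv, Real.norm_of_nonneg hr.le]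
    have hFy : F y = Real.log (1 + r⁻¹ * ‖x - y‖) * ‖x - y‖ ^ (-((N : ℝ) + s)) := by
      simp only [hF, hG, hnorm]
      rw [mul_left_comm, ← Real.mul_rpow hr.le (by positivity), mul_inv_cancel_left₀ hr.ne']
    rw [hFy]
    have hle : ‖y‖ ≤ r + ‖x - y‖ := by
      have := norm_sub_norm_le y x
      rw [norm_sub_rev] at this
      linarith
    gcongr
    · exact div_pos (hr.trans hy) hr
    · rw [div_le_iff₀ hr]
      field_simp
      exact hle
  calc ∫⁻ y in {y : EuclideanSpace ℝ (Fin N) | r < ‖y‖ ∧ ‖y‖ < R},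
          ENNReal.ofReal (Real.log (‖y‖ / r) * ‖x - y‖ ^ (-((N : ℝ) + s)))
      ≤ ∫⁻ y in {y : EuclideanSpace ℝ (Fin N) | r < ‖y‖ ∧ ‖y‖ < R}, ENNReal.ofReal (F y) :=
        setLIntegral_mono' ((measurableSet_lt measurable_const measurable_norm).inter
          (measurableSet_lt measurable_norm measurable_const))
          fun y hy => ENNReal.ofReal_le_ofReal (hbound y hy)
    _ ≤ ∫⁻ y, ENNReal.ofReal (F y) := setLIntegral_le_lintegral _ _
    _ = ENNReal.ofReal ((∫ w, G w) * r ^ (-s)) := by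
        rw [← ofReal_integral_eq_lintegral_ofReal hFint (Filter.Eventually.of_forall hF₀), hFI]
    _ ≤ _ := by
        refine ENNReal.ofReal_le_ofReal ?_
        calc (∫ w, G w) * r ^ (-s) ≤ ((∫ w, G w) + 1) * r ^ (-s) := by
              gcongr
              linarith
          _ ≤ _ := le_mul_of_one_le_right (by positivity)
              (by linarith [Real.sqrt_nonneg (Real.log (R / r))])
end

section
/- Let N ≥ 1 be an integer and s ∈ (0,1). There exists a constant C > 0, depending only on N and s, such that for all 0 < r and R > 2r and every x ∈ ℝ^N with |x| < r, one has ∫_{2r < |y| < R} log(|y|/r) · |y−x|^{−(N+s)} dy ≤ C r^{−s} √(log(R/r)). -/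
open MeasureTheory

/-- Scaling of a radial integral with respect to an additive Haar measure. -/
lemma lintegral_norm_div_addHaar {E : Type*} [NormedAddCommGroup E] [NormedSpace ℝ E]
    [MeasurableSpace E] [BorelSpace E] [FiniteDimensional ℝ E] (μ : Measure E)
    [μ.IsAddHaarMeasure] {g : ℝ → ENNReal} (hg : Measurable g) {r : ℝ} (hr : 0 < r) :
    ∫⁻ y, g (‖y‖ / r) ∂μ =
      ENNReal.ofReal (r ^ Module.finrank ℝ E) * ∫⁻ z, g ‖z‖ ∂μ := by
  have hgn : Measurable fun z : E => g ‖z‖ := hg.comp measurable_norm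
  have h := lintegral_map (μ := μ) hgn (measurable_const_smul r⁻¹)
  rw [Measure.map_addHaar_smul μ (inv_ne_zero hr.ne'), lintegral_smul_measure] at h
  rw [inv_pow, inv_inv, abs_of_pos (pow_pos hr _), smul_eq_mul] at h
  rw [h]
  refine lintegral_congr fun y => ?_
  rw [norm_smul, Real.norm_of_nonneg (inv_nonneg.2 hr.le), div_eq_inv_mul]

/-- Away from the ball of radius `2r`, the kernel `log (‖y‖ / r) ‖y - x‖ ^ (-(n + s))` is
controlled by an integrable power of `1 + ‖y‖ / r`, uniformly in `‖x‖ < r`. -/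
lemma log_mul_rpow_norm_sub_le {E : Type*} [NormedAddCommGroup E] {n s r : ℝ}
    (hn : 0 ≤ n) (hs : 0 < s) (hr : 0 < r) {x y : E} (hx : ‖x‖ < r) (hy : 2 * r < ‖y‖) :
    Real.log (‖y‖ / r) * ‖y - x‖ ^ (-(n + s)) ≤
      2 / s * 4 ^ (n + s) * r ^ (-(n + s)) * (1 + ‖y‖ / r) ^ (-(n + s / 2)) := by
  set t := ‖y‖ / r with ht
  have hyt : ‖y‖ = r * t := by rw [ht]; field_simp
  have ht2 : 2 < t := by rwa [ht, lt_div_iff₀ hr]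
  have hlog : Real.log t ≤ 2 / s * (1 + t) ^ (s / 2) := by
    calc Real.log t ≤ t ^ (s / 2) / (s / 2) := Real.log_le_rpow_div (by linarith) (by linarith)
      _ = 2 / s * t ^ (s / 2) := by field_simp
      _ ≤ _ := by gcongr; linarith
  have hdist : r * (1 + t) / 4 ≤ ‖y - x‖ := by
    have := norm_sub_norm_le y x
    nlinarith
  have hker : ‖y - x‖ ^ (-(n + s)) ≤ 4 ^ (n + s) * r ^ (-(n + s)) * (1 + t) ^ (-(n + s)) := by
    calc ‖y - x‖ ^ (-(n + s)) ≤ (r * (1 + t) / 4) ^ (-(n + s)) :=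
          Real.rpow_le_rpow_of_nonpos (by positivity) hdist (by linarith)
      _ = _ := by
        rw [Real.div_rpow (by positivity) (by norm_num), Real.mul_rpow hr.le (by linarith),
          Real.rpow_neg (by norm_num : (0 : ℝ) ≤ 4), div_inv_eq_mul]
        ring
  calc Real.log t * ‖y - x‖ ^ (-(n + s))
      ≤ (2 / s * (1 + t) ^ (s / 2)) *
          (4 ^ (n + s) * r ^ (-(n + s)) * (1 + t) ^ (-(n + s))) := by
        gcongr
    _ = 2 / s * 4 ^ (n + s) * r ^ (-(n + s)) * ((1 + t) ^ (s / 2) * (1 + t) ^ (-(n + s))) := by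
        ring
    _ = _ := by
        rw [← Real.rpow_add (by linarith)]
        ring_nf

/-- For `N ≥ 1`, `s ∈ (0,1)` there is `C = C(N,s) > 0` such that for all
`0 < r`, `R > 2r` and every `x` with `|x| < r`,
`∫_{2r<|y|<R} log(|y|/r) |y-x|^{-(N+s)} dy ≤ C r^{-s} √(log(R/r))`. -/
theorem statement6 (N : ℕ) (hN : 1 ≤ N) (s : ℝ) (hs : s ∈ Set.Ioo (0 : ℝ) 1) :
    ∃ C : ℝ, 0 < C ∧ ∀ r R : ℝ, 0 < r → 2 * r < R →
      ∀ x : EuclideanSpace ℝ (Fin N), ‖x‖ < r →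
      ∫⁻ y in {y : EuclideanSpace ℝ (Fin N) | 2 * r < ‖y‖ ∧ ‖y‖ < R},
          ENNReal.ofReal (Real.log (‖y‖ / r) * ‖y - x‖ ^ (-((N : ℝ) + s)))
        ≤ ENNReal.ofReal (C * r ^ (-s) * Real.sqrt (Real.log (R / r))) := by
  have hs0 : 0 < s := hs.1
  obtain ⟨J, hJ⟩ : ∃ J : NNReal, (J : ENNReal) = ∫⁻ z : EuclideanSpace ℝ (Fin N),
      ENNReal.ofReal ((1 + ‖z‖) ^ (-((N : ℝ) + s / 2))) :=
    ⟨_, ENNReal.coe_toNNReal (finite_integral_one_add_norm (by simpa using hs0)).ne⟩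
  set K : ℝ := 2 / s * 4 ^ ((N : ℝ) + s) with hK
  have hK0 : 0 < K := by positivity
  have hL : 0 < Real.sqrt (Real.log 2) := Real.sqrt_pos.2 (Real.log_pos (by norm_num))
  refine ⟨(K * J + 1) / Real.sqrt (Real.log 2), by positivity, fun r R hr hR x hx => ?_⟩
  have hc : 0 ≤ K * r ^ (-((N : ℝ) + s)) := by positivity
  have hmeas : MeasurableSet {y : EuclideanSpace ℝ (Fin N) | 2 * r < ‖y‖ ∧ ‖y‖ < R} :=
    (measurableSet_lt measurable_const measurable_norm).inter
      (measurableSet_lt measurable_norm measurable_const)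
  have hpow : r ^ (-((N : ℝ) + s)) * r ^ N = r ^ (-s) := by
    rw [← Real.rpow_natCast, ← Real.rpow_add hr]
    ring_nf
  have hlog : Real.sqrt (Real.log 2) ≤ Real.sqrt (Real.log (R / r)) :=
    Real.sqrt_le_sqrt (Real.log_le_log (by norm_num) ((le_div_iff₀ hr).2 hR.le))
  calc _ ≤ ∫⁻ y in {y : EuclideanSpace ℝ (Fin N) | 2 * r < ‖y‖ ∧ ‖y‖ < R},
          ENNReal.ofReal (K * r ^ (-((N : ℝ) + s))) *
            ENNReal.ofReal ((1 + ‖y‖ / r) ^ (-((N : ℝ) + s / 2))) := by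
        refine setLIntegral_mono' hmeas fun y hy => ?_
        rw [← ENNReal.ofReal_mul hc]
        exact ENNReal.ofReal_le_ofReal
          (log_mul_rpow_norm_sub_le (Nat.cast_nonneg N) hs0 hr hx hy.1)
    _ ≤ ∫⁻ y : EuclideanSpace ℝ (Fin N), ENNReal.ofReal (K * r ^ (-((N : ℝ) + s))) *
            ENNReal.ofReal ((1 + ‖y‖ / r) ^ (-((N : ℝ) + s / 2))) :=
        setLIntegral_le_lintegral _ _
    _ = ENNReal.ofReal (K * r ^ (-((N : ℝ) + s))) * (ENNReal.ofReal (r ^ N) * J) := by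
        rw [lintegral_const_mul' _ _ ENNReal.ofReal_ne_top, lintegral_norm_div_addHaar volume
          (g := fun t => ENNReal.ofReal ((1 + t) ^ (-((N : ℝ) + s / 2)))) (by fun_prop) hr,
          finrank_euclideanSpace_fin, hJ]
    _ = ENNReal.ofReal (K * J * r ^ (-s)) := by
        rw [← ENNReal.ofReal_coe_nnreal, ← ENNReal.ofReal_mul (by positivity),
          ← ENNReal.ofReal_mul hc, ← hpow]
        ring_nf
    _ ≤ _ := by
        refine ENNReal.ofReal_le_ofReal ?_
        calc K * J * r ^ (-s) ≤ (K * J + 1) * r ^ (-s) := by gcongr; linarith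
          _ = (K * J + 1) / Real.sqrt (Real.log 2) * r ^ (-s) * Real.sqrt (Real.log 2) := by
            field_simp
          _ ≤ _ := by gcongr
end

section
/- Let N ≥ 1 be an integer and s ∈ (0,1). There exists a constant C > 0, depending only on N and s, such that for every x ∈ ℝ^N with |x| ≥ 1, one has ∫_{1/2 ≤ |y| ≤ |x|/2} log(|x|/|y|) · |x−y|^{−(N+s)} dy ≤ C |x|^{−s} (1 + √(log|x|)). -/
open MeasureTheory

section

open Module Set

theorem pow_smul_indicator_rpow_eqOn (n : ℕ) (p R : ℝ) :
    EqOn (fun r : ℝ => r ^ n • (Iio R).indicator (fun r => r ^ p) r)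
      ((Iio R).indicator fun r => r ^ ((n : ℝ) + p)) (Ioi 0) := by
  intro r (hr : 0 < r)
  by_cases h : r < R
  · simp [h, Real.rpow_add hr]
  · simp [h]

variable {E : Type*} [NormedAddCommGroup E] [NormedSpace ℝ E] [FiniteDimensional ℝ E]
  [MeasurableSpace E] [BorelSpace E] [Nontrivial E] (μ : Measure E) [μ.IsAddHaarMeasure]

theorem integrable_indicator_norm_rpow {p R : ℝ} (hR : 0 < R) (hp : -(finrank ℝ E : ℝ) < p) :
    Integrable (fun y : E => (Iio R).indicator (fun r => r ^ p) ‖y‖) μ := by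
  have hd : 1 ≤ finrank ℝ E := finrank_pos
  rw [integrable_fun_norm_addHaar μ (f := (Iio R).indicator fun r => r ^ p),
    integrableOn_congr_fun (pow_smul_indicator_rpow_eqOn _ p R) measurableSet_Ioi, IntegrableOn,
    integrable_indicator_iff measurableSet_Iio, IntegrableOn,
    Measure.restrict_restrict measurableSet_Iio, Iio_inter_Ioi, ← IntegrableOn,
    intervalIntegral.integrableOn_Ioo_rpow_iff hR]
  push_cast [hd]
  linarith

theorem integral_indicator_norm_rpow {p R : ℝ} (hR : 0 < R) (hp : -(finrank ℝ E : ℝ) < p) :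
    ∫ y : E, (Iio R).indicator (fun r => r ^ p) ‖y‖ ∂μ =
      finrank ℝ E * μ.real (Metric.ball 0 1) *
        (R ^ (finrank ℝ E + p) / (finrank ℝ E + p)) := by
  have hd : 1 ≤ finrank ℝ E := finrank_pos
  have hexp : ((finrank ℝ E - 1 : ℕ) : ℝ) + p + 1 = finrank ℝ E + p := by
    push_cast [hd]
    ring
  rw [integral_fun_norm_addHaar μ ((Iio R).indicator fun r => r ^ p),
    setIntegral_congr_fun measurableSet_Ioi (pow_smul_indicator_rpow_eqOn _ p R),
    integral_indicator measurableSet_Iio, Measure.restrict_restrict measurableSet_Iio,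
    Iio_inter_Ioi, ← integral_Ioc_eq_integral_Ioo, ← intervalIntegral.integral_of_le hR.le,
    integral_rpow (Or.inl (by linarith)), hexp, Real.zero_rpow (by linarith)]
  simp [mul_assoc]

end

/-- Away from `x`, the logarithmic weight is controlled by an integrable power of the norm. -/
theorem log_div_mul_norm_sub_rpow_le {E : Type*} [NormedAddCommGroup E] {x y : E} {a : ℝ}
    (ha : 0 ≤ a) (hy : 0 < ‖y‖) (hyx : ‖y‖ ≤ ‖x‖ / 2) :
    Real.log (‖x‖ / ‖y‖) * ‖x - y‖ ^ (-a) ≤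
      2 * 2 ^ a * ‖x‖ ^ (1 / 2 - a) * ‖y‖ ^ (-(1 / 2) : ℝ) := by
  have hx : 0 < ‖x‖ := by linarith
  have hsub : ‖x‖ / 2 ≤ ‖x - y‖ := by linarith [norm_sub_norm_le x y]
  have hlog : Real.log (‖x‖ / ‖y‖) ≤ (‖x‖ / ‖y‖) ^ (1 / 2 : ℝ) / (1 / 2) :=
    Real.log_le_rpow_div (by positivity) (by norm_num)
  have hpow : ‖x - y‖ ^ (-a) ≤ (‖x‖ / 2) ^ (-a) :=
    Real.rpow_le_rpow_of_nonpos (by positivity) hsub (by linarith)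
  calc _ ≤ (‖x‖ / ‖y‖) ^ (1 / 2 : ℝ) / (1 / 2) * (‖x‖ / 2) ^ (-a) := by gcongr
    _ = _ := by
      rw [Real.div_rpow hx.le hy.le, Real.div_rpow hx.le two_pos.le, Real.rpow_neg two_pos.le,
        Real.rpow_neg hy.le, sub_eq_add_neg, Real.rpow_add hx]
      field_simp

/-- For `N ≥ 1`, `s ∈ (0,1)` there is `C = C(N,s) > 0` such that for every
`x` with `|x| ≥ 1`,
`∫_{1/2 ≤ |y| ≤ |x|/2} log(|x|/|y|) |x-y|^{-(N+s)} dy ≤ C |x|^{-s} (1 + √(log|x|))`. -/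
theorem statement7 (N : ℕ) (hN : 1 ≤ N) (s : ℝ) (hs : s ∈ Set.Ioo (0 : ℝ) 1) :
    ∃ C : ℝ, 0 < C ∧ ∀ x : EuclideanSpace ℝ (Fin N), 1 ≤ ‖x‖ →
      ∫⁻ y in {y : EuclideanSpace ℝ (Fin N) | 1 / 2 ≤ ‖y‖ ∧ ‖y‖ ≤ ‖x‖ / 2},
          ENNReal.ofReal (Real.log (‖x‖ / ‖y‖) * ‖x - y‖ ^ (-((N : ℝ) + s)))
        ≤ ENNReal.ofReal (C * ‖x‖ ^ (-s) * (1 + Real.sqrt (Real.log ‖x‖))) := by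
  have hN' : (1 : ℝ) ≤ N := by exact_mod_cast hN
  have hs0 : 0 < s := hs.1
  have : Nonempty (Fin N) := ⟨⟨0, hN⟩⟩
  set V := (volume : Measure (EuclideanSpace ℝ (Fin N))).real (Metric.ball 0 1)
  have hV : 0 < V :=
    ENNReal.toReal_pos (Metric.measure_ball_pos _ _ one_pos).ne' measure_ball_lt_top.ne
  have hhalf : 0 < (N : ℝ) + -(1 / 2) := by linarith
  refine ⟨2 * 2 ^ ((N : ℝ) + s) * (N * V / (N + -(1 / 2))), by positivity, fun x hx => ?_⟩
  have hx0 : 0 < ‖x‖ := by linarith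
  set K : ℝ := 2 * 2 ^ ((N : ℝ) + s) * ‖x‖ ^ (1 / 2 - ((N : ℝ) + s))
  set f : EuclideanSpace ℝ (Fin N) → ℝ :=
    fun y => (Set.Iio ‖x‖).indicator (fun r => r ^ (-(1 / 2) : ℝ)) ‖y‖
  have hp : -(Module.finrank ℝ (EuclideanSpace ℝ (Fin N)) : ℝ) < -(1 / 2) := by
    rw [finrank_euclideanSpace_fin]
    linarith
  have hint : Integrable f := integrable_indicator_norm_rpow volume hx0 hp
  have hfval : ∫ y, f y = N * V * (‖x‖ ^ ((N : ℝ) + -(1 / 2)) / (N + -(1 / 2))) := by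
    simpa only [finrank_euclideanSpace_fin] using integral_indicator_norm_rpow volume hx0 hp
  have hf0 (y) : 0 ≤ f y :=
    Set.indicator_apply_nonneg fun _ => Real.rpow_nonneg (norm_nonneg y) _
  have hmeas : MeasurableSet {y : EuclideanSpace ℝ (Fin N) | 1 / 2 ≤ ‖y‖ ∧ ‖y‖ ≤ ‖x‖ / 2} :=
    (measurableSet_le measurable_const measurable_norm).inter
      (measurableSet_le measurable_norm measurable_const)
  calc _ ≤ ∫⁻ y in {y : EuclideanSpace ℝ (Fin N) | 1 / 2 ≤ ‖y‖ ∧ ‖y‖ ≤ ‖x‖ / 2},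
          ENNReal.ofReal (K * f y) := by
        refine setLIntegral_mono' hmeas fun y ⟨hy, hyx⟩ => ENNReal.ofReal_le_ofReal ?_
        have hfy : f y = ‖y‖ ^ (-(1 / 2) : ℝ) :=
          Set.indicator_of_mem (Set.mem_Iio.2 (by linarith)) _
        rw [hfy]
        exact log_div_mul_norm_sub_rpow_le (by positivity) (by linarith) hyx
    _ ≤ ∫⁻ y, ENNReal.ofReal (K * f y) := setLIntegral_le_lintegral _ _
    _ = ENNReal.ofReal (∫ y, K * f y) :=
        (ofReal_integral_eq_lintegral_ofReal (hint.const_mul K)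
          (.of_forall fun y => mul_nonneg (by positivity) (hf0 y))).symm
    _ ≤ _ := ENNReal.ofReal_le_ofReal ?_
  have hpow : ‖x‖ ^ (1 / 2 - ((N : ℝ) + s)) * ‖x‖ ^ ((N : ℝ) + -(1 / 2)) = ‖x‖ ^ (-s) := by
    rw [← Real.rpow_add hx0]
    ring_nf
  calc ∫ y, K * f y
      = 2 * 2 ^ ((N : ℝ) + s) * (N * V / (N + -(1 / 2))) * ‖x‖ ^ (-s) := by
        rw [integral_const_mul, hfval, ← hpow]
        ring
    _ ≤ _ := le_mul_of_one_le_right (by positivity) (by linarith [Real.sqrt_nonneg (Real.log ‖x‖)])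
end

section
/- Let N ≥ 1 be an integer and s ∈ (0,1). There exists a constant C > 0, depending only on N and s, such that for every x ∈ ℝ^N with x ≠ 0, one has ∫_{|x|/2 < |y| < 2|x|} |log(|y|/|x|)| · |x−y|^{−(N+s)} dy ≤ C |x|^{−s}. -/
open MeasureTheory

/-- The integral of `‖z‖ ^ p` over a centred ball, for `p` above the critical exponent `-dim E`. -/
lemma lintegral_ball_norm_rpow {E : Type*} [NormedAddCommGroup E] [NormedSpace ℝ E]
    [FiniteDimensional ℝ E] [Nontrivial E] [MeasurableSpace E] [BorelSpace E]
    (μ : Measure E) [μ.IsAddHaarMeasure] {p R : ℝ} (hR : 0 ≤ R)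
    (hp : 0 < Module.finrank ℝ E + p) :
    ∫⁻ z in Metric.ball (0 : E) R, ENNReal.ofReal (‖z‖ ^ p) ∂μ =
      ENNReal.ofReal (Module.finrank ℝ E * μ.real (Metric.ball 0 1) *
        (R ^ (Module.finrank ℝ E + p) / (Module.finrank ℝ E + p))) := by
  set d := Module.finrank ℝ E with hd
  have hd1 : 1 ≤ d := Module.finrank_pos
  have key : Set.EqOn (fun t : ℝ => t ^ (d - 1) • t ^ p) (fun t => t ^ (d + p - 1))
      (Set.Ioi 0) := by
    intro t ht
    have ht : 0 < t := ht
    simp only [smul_eq_mul]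
    rw [← Real.rpow_natCast, ← Real.rpow_add ht, Nat.cast_sub hd1]
    congr 1
    push_cast
    ring
  have hInt : IntegrableOn (fun z : E => ‖z‖ ^ p) (Metric.ball 0 R) μ := by
    rw [integrableOn_fun_norm_addHaar μ (f := fun t : ℝ => t ^ p),
      integrableOn_congr_fun (key.mono Set.Ioo_subset_Ioi_self) measurableSet_Ioo,
      ← intervalIntegrable_iff_integrableOn_Ioo_of_le hR]
    exact intervalIntegral.intervalIntegrable_rpow' (by linarith)
  rw [← ofReal_integral_eq_lintegral_ofReal hInt
    (Filter.Eventually.of_forall fun z => Real.rpow_nonneg (norm_nonneg z) p)]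
  congr 1
  have hball : ∫ z in Metric.ball (0 : E) R, ‖z‖ ^ p ∂μ =
      ∫ z, (Set.Iio R).indicator (fun t : ℝ => t ^ p) ‖z‖ ∂μ := by
    rw [← integral_indicator Metric.isOpen_ball.measurableSet]
    refine integral_congr_ae (Filter.Eventually.of_forall fun z => ?_)
    simp [Set.indicator]
  have hrad : ∫ t in Set.Ioi (0 : ℝ), t ^ (d - 1) • (Set.Iio R).indicator (fun t : ℝ => t ^ p) t =
      R ^ (d + p) / (d + p) := by
    calc
      _ = ∫ t in Set.Ioi (0 : ℝ), (Set.Iio R).indicator (fun t : ℝ => t ^ (d + p - 1)) t := by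
        refine setIntegral_congr_fun measurableSet_Ioi fun t ht => ?_
        by_cases h : t ∈ Set.Iio R
        · simpa only [Set.indicator_of_mem h] using key ht
        · simp only [Set.indicator_of_notMem h, smul_zero]
      _ = ∫ t in (0 : ℝ)..R, t ^ (d + p - 1) := by
        rw [setIntegral_indicator measurableSet_Iio, Set.Ioi_inter_Iio,
          intervalIntegral.integral_of_le hR, integral_Ioc_eq_integral_Ioo]
      _ = R ^ (d + p) / (d + p) := by
        rw [integral_rpow (Or.inl (by linarith)), sub_add_cancel, Real.zero_rpow hp.ne', sub_zero]
  rw [hball, integral_fun_norm_addHaar, ← hd, hrad]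
  simp only [nsmul_eq_mul, smul_eq_mul]
  ring

/-- On `[1/2, ∞)` the logarithm is at most `2` times the distance to `1`. -/
lemma abs_log_le_two_mul_abs_sub_one {t : ℝ} (ht : 1 / 2 ≤ t) :
    |Real.log t| ≤ 2 * |t - 1| := by
  have ht0 : 0 < t := by linarith
  have hle := Real.log_le_sub_one_of_pos ht0
  have hge := Real.one_sub_inv_le_log_of_pos ht0
  have hinv : t * t⁻¹ = 1 := mul_inv_cancel₀ ht0.ne'
  have hinv2 : t⁻¹ ≤ 2 := by
    rw [inv_le_comm₀ ht0 two_pos]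
    linarith
  rw [abs_le]
  rcases abs_cases (t - 1) with ⟨h, h'⟩ | ⟨h, h'⟩ <;> rw [h] <;> constructor <;>
    nlinarith [inv_pos.mpr ht0]

lemma abs_log_norm_div_norm_mul_rpow_le {E : Type*} [NormedAddCommGroup E] {x y : E}
    (hx : x ≠ 0) (hy : ‖x‖ / 2 < ‖y‖) (q : ℝ) :
    |Real.log (‖y‖ / ‖x‖)| * ‖x - y‖ ^ q ≤ 2 / ‖x‖ * ‖x - y‖ ^ (q + 1) := by
  have hx0 : 0 < ‖x‖ := norm_pos_iff.mpr hx
  rcases eq_or_ne x y with rfl | hxy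
  · rw [div_self hx0.ne', Real.log_one, abs_zero, zero_mul]
    positivity
  have hlog : |Real.log (‖y‖ / ‖x‖)| ≤ 2 / ‖x‖ * ‖x - y‖ := by
    have h1 : 1 / 2 ≤ ‖y‖ / ‖x‖ := by
      rw [le_div_iff₀ hx0]
      linarith
    calc |Real.log (‖y‖ / ‖x‖)| ≤ 2 * |‖y‖ / ‖x‖ - 1| := abs_log_le_two_mul_abs_sub_one h1
      _ = 2 / ‖x‖ * |‖y‖ - ‖x‖| := by
        rw [div_sub_one hx0.ne', abs_div, abs_of_pos hx0]
        ring
      _ ≤ 2 / ‖x‖ * ‖x - y‖ := by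
        gcongr
        rw [norm_sub_rev]
        exact abs_norm_sub_norm_le y x
  calc _ ≤ 2 / ‖x‖ * ‖x - y‖ * ‖x - y‖ ^ q := by gcongr
    _ = _ := by
      rw [Real.rpow_add_one (norm_ne_zero_iff.mpr (sub_ne_zero.mpr hxy))]
      ring

/-- For `N ≥ 1`, `s ∈ (0,1)` there is `C = C(N,s) > 0` such that for every
`x ≠ 0`, `∫_{|x|/2<|y|<2|x|} |log(|y|/|x|)| |x-y|^{-(N+s)} dy ≤ C |x|^{-s}`. -/
theorem statement8 (N : ℕ) (hN : 1 ≤ N) (s : ℝ) (hs : s ∈ Set.Ioo (0 : ℝ) 1) :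
    ∃ C : ℝ, 0 < C ∧ ∀ x : EuclideanSpace ℝ (Fin N), x ≠ 0 →
      ∫⁻ y in {y : EuclideanSpace ℝ (Fin N) | ‖x‖ / 2 < ‖y‖ ∧ ‖y‖ < 2 * ‖x‖},
          ENNReal.ofReal (|Real.log (‖y‖ / ‖x‖)| * ‖x - y‖ ^ (-((N : ℝ) + s)))
        ≤ ENNReal.ofReal (C * ‖x‖ ^ (-s)) := by
  obtain ⟨-, hs1⟩ := hs
  have : Nonempty (Fin N) := ⟨⟨0, hN⟩⟩
  have hs1' : 0 < 1 - s := by linarith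
  have hN0 : (0 : ℝ) < N := by exact_mod_cast hN
  set V : ℝ := (volume : Measure (EuclideanSpace ℝ (Fin N))).real (Metric.ball 0 1)
  have hV0 : 0 < V :=
    ENNReal.toReal_pos (Metric.measure_ball_pos _ _ one_pos).ne' measure_ball_lt_top.ne
  refine ⟨2 * (N * V * (3 ^ (1 - s) / (1 - s))), by positivity, fun x hx => ?_⟩
  have hx0 : 0 < ‖x‖ := norm_pos_iff.mpr hx
  set p : ℝ := -((N : ℝ) + s) + 1 with hp
  have hNp : (N : ℝ) + p = 1 - s := by rw [hp]; ring
  set A := {y : EuclideanSpace ℝ (Fin N) | ‖x‖ / 2 < ‖y‖ ∧ ‖y‖ < 2 * ‖x‖}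
  have hA : MeasurableSet A :=
    (measurableSet_lt measurable_const measurable_norm).inter
      (measurableSet_lt measurable_norm measurable_const)
  let F : EuclideanSpace ℝ (Fin N) → ENNReal :=
    (Metric.ball 0 (3 * ‖x‖)).indicator fun z => ENNReal.ofReal (‖z‖ ^ p)
  have hbound : ∀ y ∈ A, ENNReal.ofReal (|Real.log (‖y‖ / ‖x‖)| * ‖x - y‖ ^ (-((N : ℝ) + s))) ≤
      ENNReal.ofReal (2 / ‖x‖) * F (x - y) := by
    rintro y ⟨hy1, hy2⟩
    have hmem : x - y ∈ Metric.ball (0 : EuclideanSpace ℝ (Fin N)) (3 * ‖x‖) := by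
      rw [mem_ball_zero_iff]
      linarith [norm_sub_le x y]
    simp only [F, Set.indicator_of_mem hmem]
    rw [← ENNReal.ofReal_mul (by positivity)]
    exact ENNReal.ofReal_le_ofReal (abs_log_norm_div_norm_mul_rpow_le hx hy1 _)
  calc
    _ ≤ ∫⁻ y in A, ENNReal.ofReal (2 / ‖x‖) * F (x - y) := setLIntegral_mono' hA hbound
    _ ≤ ∫⁻ y, ENNReal.ofReal (2 / ‖x‖) * F (x - y) := setLIntegral_le_lintegral _ _
    _ = ENNReal.ofReal (2 / ‖x‖) * ∫⁻ z in Metric.ball (0 : EuclideanSpace ℝ (Fin N)) (3 * ‖x‖),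
          ENNReal.ofReal (‖z‖ ^ p) := by
      rw [lintegral_const_mul' _ _ ENNReal.ofReal_ne_top, lintegral_sub_left_eq_self F x,
        lintegral_indicator Metric.isOpen_ball.measurableSet]
    _ = ENNReal.ofReal (2 / ‖x‖ * (N * V * ((3 * ‖x‖) ^ (1 - s) / (1 - s)))) := by
      rw [lintegral_ball_norm_rpow volume (by positivity)
        (by rw [finrank_euclideanSpace_fin, hNp]; exact hs1'), finrank_euclideanSpace_fin, hNp,
        ← ENNReal.ofReal_mul (by positivity)]
    _ = _ := by
      congr 1
      rw [Real.mul_rpow (by norm_num) hx0.le, sub_eq_add_neg, Real.rpow_add hx0, Real.rpow_one]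
      field_simp
end

section
/- Let s ∈ (0,1), let N > 2s be an integer, and let t ∈ (0, 2s). Set 2* = 2(N−t)/(N−2s) and q = 2·2*/(2*−2). Then there exists a constant C > 0, depending only on N, s, t, such that for all 0 < r < R, ∫_{|x| < r} |x|^{qt/2*} ( ∫_{|y| > R} |x−y|^{−(N+s)} dy )^q dx ≤ C (r/(R−r))^{sq}. -/
open MeasureTheory

/-- Translation and scaling of the integrable tail `(1 + ‖y‖) ^ (-(N + s))`: outside a ball at
distance `R - r` from `x`, the kernel `‖x - y‖ ^ (-(N + s))` has mass at most a constant times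
`(R - r) ^ (-s)`. -/
theorem setIntegral_norm_sub_rpow_le {N : ℕ} {s r R : ℝ} (hs : 0 < s) (hrR : r < R)
    {x : EuclideanSpace ℝ (Fin N)} (hx : ‖x‖ < r) :
    ∫ y in {y : EuclideanSpace ℝ (Fin N) | R < ‖y‖}, ‖x - y‖ ^ (-((N : ℝ) + s)) ≤
      2 ^ ((N : ℝ) + s) * (∫ y : EuclideanSpace ℝ (Fin N), (1 + ‖y‖) ^ (-((N : ℝ) + s))) *
        (R - r) ^ (-s) := by
  set p : ℝ := (N : ℝ) + s with hp
  have hp0 : 0 < p := by positivity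
  set d : ℝ := R - r with hd
  have hd0 : 0 < d := by rw [hd]; linarith
  set g : EuclideanSpace ℝ (Fin N) → ℝ := fun y ↦ (1 + ‖y‖) ^ (-p) with hg
  have hgi : Integrable g := integrable_one_add_norm (by simp [hp, hs])
  have hgdi : Integrable (fun y ↦ g (d⁻¹ • (x - y))) :=
    (hgi.comp_smul (inv_ne_zero hd0.ne')).comp_sub_left x
  have hGi : Integrable (fun y ↦ 2 ^ p * d ^ (-p) * g (d⁻¹ • (x - y))) := hgdi.const_mul _
  have hS : MeasurableSet {y : EuclideanSpace ℝ (Fin N) | R < ‖y‖} :=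
    measurableSet_lt measurable_const measurable_norm
  have hbound : ∀ y ∈ {y : EuclideanSpace ℝ (Fin N) | R < ‖y‖},
      ‖x - y‖ ^ (-p) ≤ 2 ^ p * d ^ (-p) * g (d⁻¹ • (x - y)) := by
    intro y hy
    have hy' : R < ‖y‖ := hy
    have hxy : d < ‖x - y‖ := by
      have := norm_sub_norm_le y x
      rw [norm_sub_rev] at this
      rw [hd]; linarith
    have h2 : (2 : ℝ) ^ p = (2⁻¹ : ℝ) ^ (-p) := by
      rw [Real.rpow_neg (by norm_num), Real.inv_rpow (by norm_num), inv_inv]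
    rw [hg, h2, ← Real.mul_rpow (by norm_num) hd0.le, ← Real.mul_rpow (by positivity) (by positivity)]
    apply Real.rpow_le_rpow_of_nonpos (by positivity) _ (by linarith)
    rw [norm_smul, norm_inv, Real.norm_of_nonneg hd0.le]
    have : 2⁻¹ * d * (1 + d⁻¹ * ‖x - y‖) = (d + ‖x - y‖) / 2 := by field_simp
    rw [this]; linarith
  calc _ ≤ ∫ y in {y : EuclideanSpace ℝ (Fin N) | R < ‖y‖},
        2 ^ p * d ^ (-p) * g (d⁻¹ • (x - y)) := by
        apply integral_mono_of_nonneg (.of_forall fun y ↦ by positivity) hGi.integrableOn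
        exact (ae_restrict_iff' hS).2 (.of_forall hbound)
    _ ≤ ∫ y, 2 ^ p * d ^ (-p) * g (d⁻¹ • (x - y)) :=
        setIntegral_le_integral hGi (.of_forall fun y ↦ by simp only [hg]; positivity)
    _ = 2 ^ p * (∫ y, g y) * d ^ (-s) := by
        rw [integral_const_mul, integral_sub_left_eq_self (fun y ↦ g (d⁻¹ • y)) volume x,
          Measure.integral_comp_smul, finrank_euclideanSpace_fin, inv_pow, inv_inv,
          abs_of_pos (by positivity), smul_eq_mul]
        have : d ^ (-s) = d ^ (-p) * d ^ N := by
          rw [← Real.rpow_natCast, ← Real.rpow_add hd0]; congr 1; rw [hp]; ring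
        rw [this]; ring

/-- For `s ∈ (0,1)`, integer `N > 2s`, `t ∈ (0,2s)`,
`2* = 2(N-t)/(N-2s)`, `q = 2·2*/(2*-2)`: there is `C = C(N,s,t) > 0` such that for all
`0 < r < R`,
`∫_{|x|<r} |x|^{qt/2*} (∫_{|y|>R} |x-y|^{-(N+s)} dy)^q dx ≤ C (r/(R-r))^{sq}`. -/
theorem statement9 (N : ℕ) (s t : ℝ) (hs : s ∈ Set.Ioo (0 : ℝ) 1) (hN : 2 * s < N)
    (ht : t ∈ Set.Ioo (0 : ℝ) (2 * s)) (twoStar q : ℝ)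
    (htwoStar : twoStar = 2 * ((N : ℝ) - t) / ((N : ℝ) - 2 * s))
    (hq : q = 2 * twoStar / (twoStar - 2)) :
    ∃ C : ℝ, 0 < C ∧ ∀ r R : ℝ, 0 < r → r < R →
      ∫⁻ x in {x : EuclideanSpace ℝ (Fin N) | ‖x‖ < r},
          ENNReal.ofReal (‖x‖ ^ (q * t / twoStar) *
            (∫ y in {y : EuclideanSpace ℝ (Fin N) | R < ‖y‖},
              ‖x - y‖ ^ (-((N : ℝ) + s))) ^ q)
        ≤ ENNReal.ofReal (C * (r / (R - r)) ^ (s * q)) := by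
  obtain ⟨hs0, -⟩ := hs
  obtain ⟨ht0, hts⟩ := ht
  have hN2 : 0 < (N : ℝ) - 2 * s := by linarith
  have hNt : 0 < (N : ℝ) - t := by linarith
  have hst : 0 < 2 * s - t := by linarith
  have htS : 0 < twoStar := by rw [htwoStar]; positivity
  have hsub : twoStar - 2 = 2 * (2 * s - t) / (N - 2 * s) := by
    rw [htwoStar]; field_simp; ring
  have hq' : q = 2 * (N - t) / (2 * s - t) := by
    rw [hq, hsub, htwoStar]; field_simp
  have hq0 : 0 < q := by rw [hq']; positivity
  have ha0 : 0 < q * t / twoStar := by positivity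
  have ha : q * t / twoStar + N = s * q := by
    rw [htwoStar, hq']; field_simp; ring
  set a := q * t / twoStar
  set K : ℝ := 2 ^ ((N : ℝ) + s) *
    ∫ y : EuclideanSpace ℝ (Fin N), (1 + ‖y‖) ^ (-((N : ℝ) + s)) with hK
  have hK0 : 0 ≤ K := mul_nonneg (by positivity) (integral_nonneg fun y ↦ by positivity)
  set V : ℝ := volume.real (Metric.ball (0 : EuclideanSpace ℝ (Fin N)) 1) with hV
  have hV0 : 0 ≤ V := measureReal_nonneg
  refine ⟨K ^ q * V + 1, by positivity, fun r R hr hrR ↦ ?_⟩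
  have hd0 : 0 < R - r := by linarith
  have hball : {x : EuclideanSpace ℝ (Fin N) | ‖x‖ < r} = Metric.ball 0 r := by
    ext; simp
  have hvol : volume (Metric.ball (0 : EuclideanSpace ℝ (Fin N)) r) =
      ENNReal.ofReal (r ^ N * V) := by
    rw [Measure.addHaar_ball_of_pos _ _ hr, finrank_euclideanSpace_fin,
      ENNReal.ofReal_mul (by positivity), hV, ofReal_measureReal measure_ball_lt_top.ne]
  calc _ ≤ ∫⁻ _ in {x : EuclideanSpace ℝ (Fin N) | ‖x‖ < r},
        ENNReal.ofReal (r ^ a * (K * (R - r) ^ (-s)) ^ q) := by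
        refine setLIntegral_mono measurable_const fun x hx ↦ ENNReal.ofReal_le_ofReal ?_
        have hx' : ‖x‖ < r := hx
        have hI := setIntegral_norm_sub_rpow_le hs0 hrR hx'
        have hI0 : 0 ≤ ∫ y in {y : EuclideanSpace ℝ (Fin N) | R < ‖y‖},
          ‖x - y‖ ^ (-((N : ℝ) + s)) := integral_nonneg fun y ↦ by positivity
        gcongr
    _ = ENNReal.ofReal (K ^ q * V * (r / (R - r)) ^ (s * q)) := by
        rw [setLIntegral_const, hball, hvol, ← ENNReal.ofReal_mul (by positivity)]
        congr 1
        rw [Real.mul_rpow hK0 (by positivity), ← Real.rpow_mul hd0.le,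
          Real.div_rpow hr.le hd0.le, neg_mul, Real.rpow_neg hd0.le, ← ha, Real.rpow_add hr a,
          Real.rpow_natCast, ha]
        ring
    _ ≤ _ := by
        apply ENNReal.ofReal_le_ofReal
        gcongr
        linarith
end

section
/- For every real p ≥ 1 there exists a constant C(p) > 0 such that for all a, b ∈ ℝ: |(a+b)|a+b|^{p−1} − a|a|^{p−1}| ≤ p|a|^{p−1}|b| + C(p)(χ_{p>2} |a|^{p−2} b² + |b|^p), where χ_{p>2} = 1 if p > 2 and χ_{p>2} = 0 if 1 ≤ p ≤ 2 (and for p > 2 the term |a|^{p−2} b² is interpreted as 0 when a = 0). -/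
/-- The tangent line inequality for `x ↦ x ^ p` at the larger endpoint. -/
lemma rpow_sub_rpow_le {p s t : ℝ} (hp : 1 ≤ p) (ht : 0 ≤ t) (hts : t ≤ s) :
    s ^ p - t ^ p ≤ p * s ^ (p - 1) * (s - t) := by
  rcases (ht.trans hts).eq_or_lt with rfl | hs
  · obtain rfl : t = 0 := le_antisymm hts ht
    simp
  · have h := one_add_mul_self_le_rpow_one_add (s := t / s - 1)
      (by linarith [div_nonneg ht hs.le]) hp
    rw [add_sub_cancel, Real.div_rpow ht hs.le, le_div_iff₀ (Real.rpow_pos_of_pos hs p)] at h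
    have hsp : s ^ p = s ^ (p - 1) * s := by
      rw [← Real.rpow_add_one hs.ne', sub_add_cancel]
    have h' : (1 + p * (t / s - 1)) * s ^ p = s ^ p + p * s ^ (p - 1) * (t - s) := by
      rw [hsp]
      field_simp
    linarith

lemma mul_abs_rpow_sub_one_of_nonneg {p s : ℝ} (hp : 1 ≤ p) (hs : 0 ≤ s) :
    s * |s| ^ (p - 1) = s ^ p := by
  rw [abs_of_nonneg hs, mul_comm]
  rcases hs.eq_or_lt with rfl | hs
  · rw [mul_zero, Real.zero_rpow (by linarith)]
  · rw [← Real.rpow_add_one hs.ne', sub_add_cancel]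

/-- The odd power function of exponent `p` is Lipschitz on `[-M, M]` with constant
`p * M ^ (p - 1)`. -/
lemma abs_oddPow_sub_le {p M s t : ℝ} (hp : 1 ≤ p) (hs : |s| ≤ M) (ht : |t| ≤ M) :
    |s * |s| ^ (p - 1) - t * |t| ^ (p - 1)| ≤ p * M ^ (p - 1) * |s - t| := by
  have hM : 0 ≤ M := (abs_nonneg s).trans hs
  have of_nonneg : ∀ {u v : ℝ}, 0 ≤ v → v ≤ u → |u| ≤ M →
      |u * |u| ^ (p - 1) - v * |v| ^ (p - 1)| ≤ p * M ^ (p - 1) * |u - v| := by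
    intro u v hv hvu hu
    have hu0 := hv.trans hvu
    rw [mul_abs_rpow_sub_one_of_nonneg hp hu0, mul_abs_rpow_sub_one_of_nonneg hp hv,
      abs_of_nonneg (sub_nonneg.2 (Real.rpow_le_rpow hv hvu (by linarith))),
      abs_of_nonneg (sub_nonneg.2 hvu)]
    refine (rpow_sub_rpow_le hp hv hvu).trans ?_
    rw [abs_of_nonneg hu0] at hu
    have := Real.rpow_le_rpow hu0 hu (sub_nonneg.2 hp)
    have := sub_nonneg.2 hvu
    gcongr
  wlog hts : t ≤ s generalizing s t
  · rw [abs_sub_comm, abs_sub_comm s]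
    exact this ht hs (le_of_not_ge hts)
  rcases le_total 0 t with h0 | h0
  · exact of_nonneg h0 hts hs
  rcases le_total s 0 with h1 | h1
  · have h := of_nonneg (neg_nonneg.2 h1) (neg_le_neg hts) (by rwa [abs_neg])
    rw [abs_neg, abs_neg] at h
    convert h using 2 <;> ring_nf
  · have hs' := Real.rpow_le_rpow (abs_nonneg s) hs (sub_nonneg.2 hp)
    have ht' := Real.rpow_le_rpow (abs_nonneg t) ht (sub_nonneg.2 hp)
    have hM' : 0 ≤ M ^ (p - 1) := by positivity
    have hs0 : 0 ≤ |s| ^ (p - 1) := by positivity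
    have ht0 : 0 ≤ |t| ^ (p - 1) := by positivity
    rw [abs_of_nonneg (sub_nonneg.2 hts), abs_of_nonneg (by nlinarith)]
    have h2 : 0 ≤ M ^ (p - 1) * (s - t) := mul_nonneg hM' (sub_nonneg.2 hts)
    nlinarith

lemma add_rpow_le_two_rpow_mul {r x y : ℝ} (hr : 0 ≤ r) (hx : 0 ≤ x) (hy : 0 ≤ y) :
    (x + y) ^ r ≤ 2 ^ r * (x ^ r + y ^ r) := by
  wlog hxy : x ≤ y generalizing x y
  · rw [add_comm x, add_comm (x ^ r)]
    exact this hy hx (le_of_not_ge hxy)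
  calc (x + y) ^ r ≤ (2 * y) ^ r := Real.rpow_le_rpow (by positivity) (by linarith) hr
    _ = 2 ^ r * y ^ r := Real.mul_rpow zero_le_two hy
    _ ≤ 2 ^ r * (x ^ r + y ^ r) := by
      gcongr
      exact le_add_of_nonneg_left (by positivity)

/-- For every real `p ≥ 1` there exists `C(p) > 0` such that for all
`a b : ℝ`, `|(a+b)|a+b|^{p-1} - a|a|^{p-1}| ≤ p|a|^{p-1}|b| + C(p)(χ_{p>2}|a|^{p-2}b² + |b|^p)`. -/
theorem statement10 (p : ℝ) (hp : 1 ≤ p) :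
    ∃ C : ℝ, 0 < C ∧ ∀ a b : ℝ,
      |(a + b) * |a + b| ^ (p - 1) - a * |a| ^ (p - 1)|
        ≤ p * |a| ^ (p - 1) * |b| +
          C * ((if 2 < p then |a| ^ (p - 2) * b ^ 2 else 0) + |b| ^ p) := by
  have lipschitz : ∀ a b : ℝ, |(a + b) * |a + b| ^ (p - 1) - a * |a| ^ (p - 1)|
      ≤ p * (|a| + |b|) ^ (p - 1) * |b| := fun a b ↦ by
    simpa using abs_oddPow_sub_le hp (abs_add_le a b) (le_add_of_nonneg_right (abs_nonneg b))
  have hbp : ∀ b : ℝ, |b| * |b| ^ (p - 1) = |b| ^ p := fun b ↦ by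
    simpa using mul_abs_rpow_sub_one_of_nonneg hp (abs_nonneg b)
  by_cases h2 : 2 < p
  · refine ⟨p * (p - 1) * 2 ^ (p - 2), by
      have : 0 < p - 1 := by linarith
      positivity, fun a b ↦ (lipschitz a b).trans ?_⟩
    rw [if_pos h2, ← hbp, ← sq_abs b]
    have hb := abs_nonneg b
    have h := rpow_sub_rpow_le (p := p - 1) (by linarith) (abs_nonneg a)
      (le_add_of_nonneg_right hb)
    have hsum := add_rpow_le_two_rpow_mul (r := p - 2) (by linarith) (abs_nonneg a) hb
    have hb' : |b| ^ (p - 1) = |b| * |b| ^ (p - 2) := by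
      have := mul_abs_rpow_sub_one_of_nonneg (p := p - 1) (by linarith) hb
      rw [abs_abs, sub_sub, one_add_one_eq_two] at this
      exact this.symm
    rw [sub_sub, one_add_one_eq_two, add_sub_cancel_left] at h
    have hp1 : 0 ≤ p - 1 := by linarith
    calc p * (|a| + |b|) ^ (p - 1) * |b|
        ≤ p * (|a| ^ (p - 1) +
            (p - 1) * (2 ^ (p - 2) * (|a| ^ (p - 2) + |b| ^ (p - 2))) * |b|) * |b| := by
          gcongr
          refine (sub_le_iff_le_add'.1 h).trans ?_
          gcongr
      _ = _ := by rw [hb']; ring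
  · refine ⟨p, by linarith, fun a b ↦ (lipschitz a b).trans ?_⟩
    rw [if_neg h2, ← hbp]
    have h := Real.rpow_add_le_add_rpow (abs_nonneg a) (abs_nonneg b) (sub_nonneg.2 hp)
      (by linarith)
    calc p * (|a| + |b|) ^ (p - 1) * |b|
        ≤ p * (|a| ^ (p - 1) + |b| ^ (p - 1)) * |b| := by gcongr
      _ = _ := by ring
end

section
/- For every real p ≥ 1 and every integer ν ≥ 1 there exists a constant C(p, ν) > 0 such that for all a₁, …, a_ν ∈ ℝ: |(Σ_{i=1}^{ν} a_i)|Σ_{i=1}^{ν} a_i|^{p−1} − Σ_{i=1}^{ν} a_i|a_i|^{p−1}| ≤ C(p, ν) Σ_{1 ≤ i ≠ j ≤ ν} |a_i|^{p−1} |a_j|. -/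
/-- A consequence of Bernoulli's inequality: the tangent line bound for `t ↦ t * t ^ q`. -/
lemma mul_rpow_sub_rpow_le {q s t : ℝ} (hq : 0 ≤ q) (ht : 0 ≤ t) (hts : t ≤ s) :
    t * (s ^ q - t ^ q) ≤ q * s ^ q * (s - t) := by
  rcases (ht.trans hts).eq_or_lt with hs | hs
  · obtain rfl : t = 0 := by linarith
    simp [← hs]
  have h := one_add_mul_self_le_rpow_one_add (s := t / s - 1) (p := q + 1)
    (by linarith [div_nonneg ht hs.le]) (by linarith)
  rw [add_sub_cancel, Real.rpow_add_one' (by positivity) (by positivity),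
    Real.div_rpow ht hs.le] at h
  have hsq : 0 < s ^ q := Real.rpow_pos_of_pos hs q
  have h' := mul_le_mul_of_nonneg_right h (mul_pos hsq hs).le
  have e₁ : (1 + (q + 1) * (t / s - 1)) * (s ^ q * s) = s ^ q * (s + (q + 1) * (t - s)) := by
    field_simp
  have e₂ : t ^ q / s ^ q * (t / s) * (s ^ q * s) = t ^ q * t := by
    field_simp
  rw [e₁, e₂] at h'
  linarith

/-- The odd power `x ↦ x * |x| ^ q` is Lipschitz on bounded sets. -/
lemma abs_mul_abs_rpow_sub_le {q K x y : ℝ} (hq : 0 ≤ q) (hx : |x| ≤ K) (hy : |y| ≤ K) :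
    |x * |x| ^ q - y * |y| ^ q| ≤ (q + 1) * K ^ q * |x - y| := by
  wlog h : |y| ≤ |x| generalizing x y
  · rw [abs_sub_comm, abs_sub_comm x]
    exact this hy hx (le_of_not_ge h)
  have hle : |y| ^ q ≤ |x| ^ q := Real.rpow_le_rpow (abs_nonneg y) h hq
  have hxq : 0 ≤ |x| ^ q := by positivity
  calc |x * |x| ^ q - y * |y| ^ q|
      = |(x - y) * |x| ^ q + y * (|x| ^ q - |y| ^ q)| := by congr 1; ring
    _ ≤ |x - y| * |x| ^ q + |y| * (|x| ^ q - |y| ^ q) := by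
      refine (abs_add_le _ _).trans_eq ?_
      rw [abs_mul, abs_mul, abs_of_nonneg hxq, abs_of_nonneg (sub_nonneg.2 hle)]
    _ ≤ |x - y| * |x| ^ q + q * |x| ^ q * (|x| - |y|) := by
      exact add_le_add_right (mul_rpow_sub_rpow_le hq (abs_nonneg y) h) _
    _ ≤ |x - y| * |x| ^ q + q * |x| ^ q * |x - y| := by
      gcongr
      exact abs_sub_abs_le_abs_sub x y
    _ = (q + 1) * |x| ^ q * |x - y| := by ring
    _ ≤ (q + 1) * K ^ q * |x - y| := by gcongr

/-- For every real `p ≥ 1` and integer `ν ≥ 1` there exists `C(p,ν) > 0`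
such that for all `a₁, …, a_ν ∈ ℝ`,
`|(Σ aᵢ)|Σ aᵢ|^{p-1} - Σ aᵢ|aᵢ|^{p-1}| ≤ C(p,ν) Σ_{i ≠ j} |aᵢ|^{p-1}|aⱼ|`. -/
theorem statement11 (p : ℝ) (hp : 1 ≤ p) (ν : ℕ) (hν : 1 ≤ ν) :
    ∃ C : ℝ, 0 < C ∧ ∀ a : Fin ν → ℝ,
      |(∑ i, a i) * |∑ i, a i| ^ (p - 1) - ∑ i, a i * |a i| ^ (p - 1)|
        ≤ C * ∑ i, ∑ j, if i ≠ j then |a i| ^ (p - 1) * |a j| else 0 := by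
  obtain ⟨q, hq, rfl⟩ : ∃ q : ℝ, 0 ≤ q ∧ p = q + 1 := ⟨p - 1, by linarith, by ring⟩
  simp only [add_sub_cancel_right]
  refine ⟨(q + 1) * (ν : ℝ) ^ q + 1, by positivity, fun a => ?_⟩
  have : Nonempty (Fin ν) := ⟨⟨0, hν⟩⟩
  obtain ⟨m, hm⟩ := Finite.exists_max fun i => |a i|
  have hν' : (1 : ℝ) ≤ ν := by exact_mod_cast hν
  set R := ∑ j ∈ Finset.univ.erase m, |a j|
  have hsum : |∑ i, a i| ≤ ν * |a m| :=
    calc |∑ i, a i| ≤ ∑ i, |a i| := Finset.abs_sum_le_sum_abs _ _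
      _ ≤ ∑ _i : Fin ν, |a m| := Finset.sum_le_sum fun i _ => hm i
      _ = ν * |a m| := by simp
  have hrow : |a m| ^ q * R ≤ ∑ i, ∑ j, if i ≠ j then |a i| ^ q * |a j| else 0 := by
    have hnonneg (i j : Fin ν) : 0 ≤ if i ≠ j then |a i| ^ q * |a j| else 0 := by
      split_ifs <;> positivity
    refine le_trans (le_of_eq ?_) (Finset.single_le_sum
      (fun i _ => Finset.sum_nonneg fun j _ => hnonneg i j) (Finset.mem_univ m))
    rw [Finset.mul_sum, ← Finset.sum_filter, Finset.filter_ne]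
  have hmain : |(∑ i, a i) * |∑ i, a i| ^ q - a m * |a m| ^ q|
      ≤ (q + 1) * (ν : ℝ) ^ q * (|a m| ^ q * R) := by
    refine (abs_mul_abs_rpow_sub_le hq hsum
      (le_mul_of_one_le_left (abs_nonneg _) hν')).trans ?_
    rw [Real.mul_rpow (by positivity) (abs_nonneg _), ← mul_assoc, ← mul_assoc]
    gcongr
    rw [← Finset.add_sum_erase _ a (Finset.mem_univ m), add_sub_cancel_left]
    exact Finset.abs_sum_le_sum_abs _ _
  have hrest : |∑ i ∈ Finset.univ.erase m, a i * |a i| ^ q| ≤ |a m| ^ q * R := by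
    refine (Finset.abs_sum_le_sum_abs _ _).trans ?_
    rw [Finset.mul_sum]
    refine Finset.sum_le_sum fun i _ => ?_
    rw [abs_mul, abs_of_nonneg (by positivity : 0 ≤ |a i| ^ q), mul_comm]
    exact mul_le_mul_of_nonneg_right (Real.rpow_le_rpow (abs_nonneg _) (hm i) hq) (abs_nonneg _)
  calc |(∑ i, a i) * |∑ i, a i| ^ q - ∑ i, a i * |a i| ^ q|
      = |((∑ i, a i) * |∑ i, a i| ^ q - a m * |a m| ^ q)
          - ∑ i ∈ Finset.univ.erase m, a i * |a i| ^ q| := by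
        rw [← Finset.add_sum_erase _ (fun i => a i * |a i| ^ q) (Finset.mem_univ m), sub_sub]
    _ ≤ (q + 1) * (ν : ℝ) ^ q * (|a m| ^ q * R) + |a m| ^ q * R :=
        (abs_sub _ _).trans (add_le_add hmain hrest)
    _ = ((q + 1) * (ν : ℝ) ^ q + 1) * (|a m| ^ q * R) := by ring
    _ ≤ _ := by gcongr
end
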